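/- Let N ≥ 2, α > 1, and ε > 0. For every loop U ∈ Lip_α(T → SU(N)) there exists a constant C (depending on α, ε, N and U) and a sequence of SU(N)-valued polynomial loops U_n of degree ≤ n (n = 0, 1, 2, …) such that ‖U − U_n‖_C := max_{t∈T} ‖U(t) − U_n(t)‖ ≤ C (n+1)^{−(α−ε)} for all n ≥ 0. -/

import Mathlib

open scoped Real

attribute [local instance] Matrix.normedAddCommGroup Matrix.normedSpace

/-- Spectral norm (operator 2-norm) of a complex `N × N` matrix. -/
noncomputable def specNorm {N : ℕ} (A : Matrix (Fin N) (Fin N) ℂ) : ℝ :=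
  ‖Matrix.toEuclideanCLM (𝕜 := ℂ) A‖

/-- The special unitary group `SU(N)` as a set of matrices. -/
def SpecialUnitary (N : ℕ) : Set (Matrix (Fin N) (Fin N) ℂ) :=
  {A | A ∈ Matrix.unitaryGroup (Fin N) ℂ ∧ A.det = 1}

/-- The Lie algebra `su(N)`: skew-Hermitian traceless matrices. -/
def SkewTraceless (N : ℕ) : Set (Matrix (Fin N) (Fin N) ℂ) :=
  {A | A.conjTranspose = -A ∧ A.trace = 0}

/-- Uniform (sup) norm of a matrix-valued function, w.r.t. the spectral norm. -/
noncomputable def unifNorm {N : ℕ} (F : ℝ → Matrix (Fin N) (Fin N) ℂ) : ℝ :=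
  ⨆ t, specNorm (F t)

/-- `P` is a polynomial loop of degree `≤ n` with values in the set `G`:
`P t = ∑_{k=-n}^{n} e^{ikt} • C_k` with constant matrix coefficients, and `P t ∈ G`. -/
def IsPolyLoop {N : ℕ} (n : ℕ) (G : Set (Matrix (Fin N) (Fin N) ℂ))
    (P : ℝ → Matrix (Fin N) (Fin N) ℂ) : Prop :=
  (∃ c : ℤ → Matrix (Fin N) (Fin N) ℂ,
    ∀ t : ℝ, P t = ∑ k ∈ Finset.Icc (-(n : ℤ)) (n : ℤ),
      Complex.exp (k * t * Complex.I) • c k) ∧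
  ∀ t : ℝ, P t ∈ G

/-- For `α > 0`, the integer `r` in the decomposition `α = r + β`, `0 < β ≤ 1`. -/
noncomputable def lipR (α : ℝ) : ℕ := ⌈α⌉₊ - 1

/-- For `α > 0`, the exponent `β ∈ (0,1]` in the decomposition `α = r + β`. -/
noncomputable def lipβ (α : ℝ) : ℝ := α - lipR α

/-- Membership in the Lipschitz class `Lip_α`: `F` is `r` times continuously
differentiable and its `r`-th derivative is `β`-Hölder. -/
def MemLip {N : ℕ} (α : ℝ) (F : ℝ → Matrix (Fin N) (Fin N) ℂ) : Prop :=
  ContDiff ℝ (lipR α : ℕ∞) F ∧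
  ∃ C : ℝ, ∀ s t : ℝ,
    specNorm (iteratedDeriv (lipR α) F t - iteratedDeriv (lipR α) F s) ≤ C * |t - s| ^ lipβ α

/-- The `Lip_α` norm: the sup norm plus the smallest Hölder constant of the
`r`-th derivative. -/
noncomputable def lipNorm {N : ℕ} (α : ℝ) (F : ℝ → Matrix (Fin N) (Fin N) ℂ) : ℝ :=
  unifNorm F + sInf {C : ℝ | 0 ≤ C ∧ ∀ s t : ℝ,
    specNorm (iteratedDeriv (lipR α) F t - iteratedDeriv (lipR α) F s) ≤ C * |t - s| ^ lipβ α}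

/-- The trigonometric monomial `t ↦ e^{ikt}`. -/
noncomputable def trigMono (k : ℤ) : ℝ → ℂ := fun t => Complex.exp (k * t * Complex.I)

/-- Trigonometric polynomials with frequencies in `[a, b]`. -/
noncomputable def trigSpan (a b : ℤ) : Submodule ℂ (ℝ → ℂ) :=
  Submodule.span ℂ (trigMono '' Set.Icc a b)

lemma trigMono_zero : trigMono 0 = 1 := by
  funext t; simp [trigMono]

lemma trigMono_mul (k l : ℤ) : trigMono k * trigMono l = trigMono (k + l) := by
  funext t
  simp only [trigMono, Pi.mul_apply, ← Complex.exp_add]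
  push_cast; ring_nf

lemma star_trigMono (k : ℤ) : star (trigMono k) = trigMono (-k) := by
  funext t
  simp only [trigMono, Pi.star_apply, ← starRingEnd_apply, ← Complex.exp_conj]
  simp

lemma trigMono_sub_apply (k : ℤ) (x s : ℝ) :
    trigMono k (x - s) = trigMono k x * trigMono (-k) s := by
  simp only [trigMono, ← Complex.exp_add]
  push_cast; ring_nf

lemma norm_trigMono (k : ℤ) (t : ℝ) : ‖trigMono k t‖ = 1 := by
  have : trigMono k t = Complex.exp ((k * t : ℝ) * Complex.I) := by simp [trigMono]
  rw [this, Complex.norm_exp_ofReal_mul_I]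

@[fun_prop]
lemma continuous_trigMono (k : ℤ) : Continuous (trigMono k) := by
  unfold trigMono; fun_prop

lemma periodic_trigMono (k : ℤ) : Function.Periodic (trigMono k) (2 * π) := by
  intro t
  simp only [trigMono]
  rw [Complex.exp_eq_exp_iff_exists_int]
  exact ⟨k, by push_cast; ring⟩

lemma integral_trigMono (k : ℤ) :
    ∫ t in (-π)..π, trigMono k t = if k = 0 then (2 * π : ℂ) else 0 := by
  split_ifs with h
  · subst h; simp [trigMono_zero]; ring
  · have hk : (k : ℂ) * Complex.I ≠ 0 := by simp [h]
    have := integral_exp_mul_complex (a := -π) (b := π) hk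
    have h2 : ∀ t : ℝ, trigMono k t = Complex.exp (k * Complex.I * t) := fun t => by
      simp only [trigMono]; ring_nf
    simp_rw [h2]
    rw [this, div_eq_zero_iff]; left
    rw [sub_eq_zero, Complex.exp_eq_exp_iff_exists_int]
    exact ⟨k, by push_cast; ring⟩

lemma trigMono_mem {a b k : ℤ} (h : k ∈ Set.Icc a b) : trigMono k ∈ trigSpan a b :=
  Submodule.subset_span ⟨k, h, rfl⟩

lemma trigSpan_mono {a b a' b' : ℤ} (ha : a' ≤ a) (hb : b ≤ b') :
    trigSpan a b ≤ trigSpan a' b' :=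
  Submodule.span_mono (Set.image_mono (Set.Icc_subset_Icc ha hb))

lemma const_mem_trigSpan {a b : ℤ} (ha : a ≤ 0) (hb : 0 ≤ b) (c : ℂ) :
    (fun _ => c) ∈ trigSpan a b := by
  have := (trigSpan a b).smul_mem c (trigMono_mem ⟨ha, hb⟩)
  convert this using 1
  funext t; simp [trigMono_zero]

lemma trigSpan_induction {a b : ℤ} {p : (ℝ → ℂ) → Prop}
    (hmono : ∀ k ∈ Set.Icc a b, p (trigMono k)) (hzero : p 0)
    (hadd : ∀ f g, p f → p g → p (f + g)) (hsmul : ∀ (c : ℂ) f, p f → p (c • f))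
    {f : ℝ → ℂ} (hf : f ∈ trigSpan a b) : p f := by
  induction hf using Submodule.span_induction with
  | mem x h => obtain ⟨k, hk, rfl⟩ := h; exact hmono k hk
  | zero => exact hzero
  | add x y _ _ hx hy => exact hadd x y hx hy
  | smul c x _ hx => exact hsmul c x hx

lemma mul_mem_trigSpan {a b c d : ℤ} {f g : ℝ → ℂ} (hf : f ∈ trigSpan a b)
    (hg : g ∈ trigSpan c d) : f * g ∈ trigSpan (a + c) (b + d) := by
  have h := Submodule.mul_mem_mul hf hg
  rw [trigSpan, trigSpan, Submodule.span_mul_span] at h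
  refine Submodule.span_mono ?_ h
  rintro _ ⟨_, ⟨k, hk, rfl⟩, _, ⟨l, hl, rfl⟩, rfl⟩
  exact ⟨k + l, ⟨add_le_add hk.1 hl.1, add_le_add hk.2 hl.2⟩, (trigMono_mul k l).symm⟩

lemma star_mem_trigSpan {a b : ℤ} {f : ℝ → ℂ} (hf : f ∈ trigSpan a b) :
    star f ∈ trigSpan (-b) (-a) := by
  refine trigSpan_induction (p := fun f => star f ∈ trigSpan (-b) (-a)) ?_ ?_ ?_ ?_ hf
  · intro k hk
    rw [star_trigMono]
    exact trigMono_mem ⟨neg_le_neg hk.2, neg_le_neg hk.1⟩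
  · simp
  · intro f g hf hg
    rw [star_add]; exact add_mem hf hg
  · intro c f hf
    rw [star_smul]; exact Submodule.smul_mem _ _ hf

lemma continuous_of_mem_trigSpan {a b : ℤ} {f : ℝ → ℂ} (hf : f ∈ trigSpan a b) :
    Continuous f :=
  trigSpan_induction (fun k _ => continuous_trigMono k) continuous_const
    (fun _ _ => Continuous.add) (fun c _ h => h.const_smul c) hf

lemma periodic_of_mem_trigSpan {a b : ℤ} {f : ℝ → ℂ} (hf : f ∈ trigSpan a b) :
    Function.Periodic f (2 * π) :=
  trigSpan_induction (p := fun f => Function.Periodic f (2 * π)) (fun k _ => periodic_trigMono k)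
    (fun _ => rfl) (fun _ _ => Function.Periodic.add) (fun c _ h => h.smul c) hf

lemma exists_coeff_of_mem_trigSpan {a b : ℤ} {f : ℝ → ℂ} (hf : f ∈ trigSpan a b) :
    ∃ c : ℤ → ℂ, ∀ t, f t = ∑ k ∈ Finset.Icc a b, c k * Complex.exp (k * t * Complex.I) := by
  refine trigSpan_induction (p := fun f => ∃ c : ℤ → ℂ, ∀ t, f t =
    ∑ k ∈ Finset.Icc a b, c k * Complex.exp (k * t * Complex.I)) ?_ ?_ ?_ ?_ hf
  · intro k hk
    refine ⟨Pi.single k 1, fun t => ?_⟩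
    rw [Finset.sum_eq_single k]
    · simp [trigMono]
    · intro l _ hl; simp [Pi.single_eq_of_ne hl]
    · intro h; exact absurd (Finset.mem_Icc.2 hk) h
  · exact ⟨0, by simp⟩
  · rintro f g ⟨c, hc⟩ ⟨d, hd⟩
    exact ⟨c + d, fun t => by simp [hc, hd, add_mul, Finset.sum_add_distrib]⟩
  · rintro z f ⟨c, hc⟩
    exact ⟨z • c, fun t => by simp [hc, Finset.mul_sum, mul_assoc]⟩

/-! ### Convolution with a trigonometric polynomial -/

lemma integral_mul_sub_mem_trigSpan {a b : ℤ} {K : ℝ → ℂ} (hK : K ∈ trigSpan a b)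
    {q : ℝ → ℂ} (hq : Continuous q) :
    (fun x => ∫ s in (-π)..π, q s * K (x - s)) ∈ trigSpan a b := by
  refine (trigSpan_induction (p := fun K => Continuous K ∧
    (fun x => ∫ s in (-π)..π, q s * K (x - s)) ∈ trigSpan a b) ?_ ?_ ?_ ?_ hK).2
  · intro k hk
    refine ⟨continuous_trigMono k, ?_⟩
    have : (fun x => ∫ s in (-π)..π, q s * trigMono k (x - s)) =
        (∫ s in (-π)..π, q s * trigMono (-k) s) • trigMono k := by
      funext x
      simp only [Pi.smul_apply, smul_eq_mul, ← intervalIntegral.integral_mul_const]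
      congr 1; funext s
      rw [trigMono_sub_apply]; ring
    rw [this]
    exact Submodule.smul_mem _ _ (trigMono_mem hk)
  · refine ⟨continuous_const, ?_⟩
    convert (trigSpan a b).zero_mem using 1
    funext x; simp
  · rintro f g ⟨hfc, hf⟩ ⟨hgc, hg⟩
    refine ⟨hfc.add hgc, ?_⟩
    convert add_mem hf hg using 1
    funext x
    simp only [Pi.add_apply, mul_add]
    exact intervalIntegral.integral_add (Continuous.intervalIntegrable (by fun_prop) _ _)
      (Continuous.intervalIntegrable (by fun_prop) _ _)
  · rintro c f ⟨hfc, hf⟩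
    refine ⟨hfc.const_smul c, ?_⟩
    convert Submodule.smul_mem _ c hf using 1
    funext x
    simp only [Pi.smul_apply, smul_eq_mul, ← intervalIntegral.integral_const_mul]
    congr 1; funext s; ring

lemma integral_comp_sub_periodic {E : Type*} [NormedAddCommGroup E] [NormedSpace ℝ E]
    {f : ℝ → E} (hf : Function.Periodic f (2 * π)) (x : ℝ) :
    ∫ s in (-π)..π, f (x - s) = ∫ s in (-π)..π, f s := by
  rw [intervalIntegral.integral_comp_sub_left]
  have h := hf.intervalIntegral_add_eq (x - π) (-π)
  rw [show x - π + 2 * π = x - -π by ring, show -π + 2 * π = π by ring] at h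
  exact h

/-- The one-sided Dirichlet sum `∑_{k<m} e^{ikt}`. -/
noncomputable def dirichletSum (m : ℕ) : ℝ → ℂ := ∑ k ∈ Finset.range m, trigMono k

lemma trigMono_natCast (k : ℕ) (t : ℝ) : trigMono k t = trigMono 1 t ^ k := by
  simp only [trigMono, ← Complex.exp_nat_mul]
  push_cast; ring_nf

lemma dirichletSum_mul (m : ℕ) (t : ℝ) :
    (1 - trigMono 1 t) * dirichletSum m t = 1 - trigMono m t := by
  simp only [dirichletSum, Finset.sum_apply, trigMono_natCast]
  exact mul_neg_geom_sum _ _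

lemma dirichletSum_mem (m : ℕ) : dirichletSum m ∈ trigSpan 0 m :=
  Submodule.sum_mem _ fun k hk => trigMono_mem ⟨by positivity, by
    exact_mod_cast (Finset.mem_range.1 hk).le⟩

@[fun_prop]
lemma continuous_dirichletSum (m : ℕ) : Continuous (dirichletSum m) :=
  continuous_of_mem_trigSpan (dirichletSum_mem m)

lemma norm_dirichletSum_le (m : ℕ) (t : ℝ) : ‖dirichletSum m t‖ ≤ m := by
  rw [dirichletSum, Finset.sum_apply]
  refine (norm_sum_le _ _).trans ?_
  simp [norm_trigMono]

lemma norm_one_sub_trigMono_one (t : ℝ) : ‖1 - trigMono 1 t‖ = 2 * |Real.sin (t / 2)| := by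
  have h := Complex.norm_exp_I_mul_ofReal_sub_one t
  rw [norm_sub_rev]
  have : trigMono 1 t = Complex.exp (Complex.I * t) := by simp [trigMono, mul_comm]
  rw [this, h]; simp

lemma abs_le_norm_one_sub_trigMono {t : ℝ} (h1 : -π ≤ t) (h2 : t ≤ π) :
    2 / π * |t| ≤ ‖1 - trigMono 1 t‖ := by
  rw [norm_one_sub_trigMono_one]
  have key : ∀ s : ℝ, 0 ≤ s → s ≤ π → 2 / π * s ≤ 2 * Real.sin (s / 2) := by
    intro s hs hs'
    have := Real.mul_le_sin (x := s / 2) (by linarith) (by linarith)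
    linarith
  rcases le_total 0 t with h | h
  · rw [abs_of_nonneg h]
    exact (key t h h2).trans (by gcongr; exact le_abs_self _)
  · rw [abs_of_nonpos h]
    refine (key (-t) (by linarith) (by linarith)).trans ?_
    rw [neg_div, Real.sin_neg]
    gcongr; exact neg_le_abs _

lemma abs_mul_norm_dirichletSum_le (m : ℕ) {t : ℝ} (h1 : -π ≤ t) (h2 : t ≤ π) :
    |t| * ‖dirichletSum m t‖ ≤ π := by
  have h := congrArg norm (dirichletSum_mul m t)
  rw [norm_mul] at h
  have h3 : ‖1 - trigMono m t‖ ≤ 2 := (norm_sub_le _ _).trans (by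
    rw [norm_trigMono]; norm_num)
  have h4 := mul_le_mul_of_nonneg_right (abs_le_norm_one_sub_trigMono h1 h2)
    (norm_nonneg (dirichletSum m t))
  rw [h] at h4
  have h5 := h4.trans h3
  have hpi := Real.pi_pos
  have : |t| * ‖dirichletSum m t‖ = (2 / π * |t| * ‖dirichletSum m t‖) * (π / 2) := by
    field_simp
  rw [this]
  calc _ ≤ 2 * (π / 2) := by gcongr
    _ = π := by ring

lemma norm_dirichletSum_le_rpow (m : ℕ) {ε : ℝ} (h0 : 0 ≤ ε) (hε : ε ≤ 1) {t : ℝ} (ht : t ≠ 0)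
    (h1 : -π ≤ t) (h2 : t ≤ π) :
    ‖dirichletSum m t‖ ≤ (m : ℝ) ^ ε * (π ^ (1 - ε) * |t| ^ (ε - 1)) := by
  have ht' : 0 < |t| := abs_pos.2 ht
  have hD := norm_nonneg (dirichletSum m t)
  have e : ‖dirichletSum m t‖ = ‖dirichletSum m t‖ ^ ε * ‖dirichletSum m t‖ ^ (1 - ε) := by
    rw [← Real.rpow_add' hD (by norm_num)]; simp
  rw [e]
  have h3 : ‖dirichletSum m t‖ ≤ π * |t|⁻¹ := by
    rw [← div_eq_mul_inv, le_div_iff₀ ht', mul_comm]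
    exact abs_mul_norm_dirichletSum_le m h1 h2
  have h4 : ‖dirichletSum m t‖ ^ (1 - ε) ≤ π ^ (1 - ε) * |t| ^ (ε - 1) := by
    refine (Real.rpow_le_rpow hD h3 (by linarith)).trans_eq ?_
    rw [Real.mul_rpow Real.pi_pos.le (by positivity), Real.inv_rpow ht'.le, ← Real.rpow_neg ht'.le]
    ring_nf
  gcongr
  exact norm_dirichletSum_le m t

lemma intervalIntegrable_abs_rpow {r : ℝ} (hr : -1 < r) (a b : ℝ) :
    IntervalIntegrable (fun t : ℝ => |t| ^ r) MeasureTheory.volume a b := by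
  have pos : ∀ c : ℝ, 0 ≤ c →
      IntervalIntegrable (fun t : ℝ => |t| ^ r) MeasureTheory.volume 0 c := by
    intro c hc
    refine (intervalIntegral.intervalIntegrable_rpow' (a := 0) (b := c) hr).congr ?_
    intro t ht
    rw [Set.uIoc_of_le hc] at ht
    simp only [abs_of_pos ht.1]
  have all : ∀ c : ℝ, IntervalIntegrable (fun t : ℝ => |t| ^ r) MeasureTheory.volume 0 c := by
    intro c
    rcases le_total 0 c with h | h
    · exact pos c h
    · have := (IntervalIntegrable.iff_comp_neg (a := 0) (b := -c)).1 (pos (-c) (by linarith))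
      simpa using this
  exact (all a).symm.trans (all b)

lemma exists_integral_norm_dirichletSum_le {ε : ℝ} (h0 : 0 < ε) (hε : ε ≤ 1) :
    ∃ C : ℝ, 0 < C ∧ ∀ m : ℕ, ∫ t in (-π)..π, ‖dirichletSum m t‖ ≤ C * (m : ℝ) ^ ε := by
  have hpi := Real.pi_pos
  set I := ∫ t in (-π)..π, π ^ (1 - ε) * |t| ^ (ε - 1) with hI
  have hI0 : 0 ≤ I := intervalIntegral.integral_nonneg (by linarith) fun t _ => by positivity
  refine ⟨I + 1, by linarith, fun m => ?_⟩
  have hint : IntervalIntegrable (fun t : ℝ => π ^ (1 - ε) * |t| ^ (ε - 1))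
      MeasureTheory.volume (-π) π :=
    (intervalIntegrable_abs_rpow (by linarith) _ _).const_mul _
  have : ∫ t in (-π)..π, ‖dirichletSum m t‖ ≤
      ∫ t in (-π)..π, (m : ℝ) ^ ε * (π ^ (1 - ε) * |t| ^ (ε - 1)) := by
    refine intervalIntegral.integral_mono_ae_restrict (by linarith)
      (Continuous.intervalIntegrable (by fun_prop) _ _) (hint.const_mul _) ?_
    have h1 : ∀ᵐ t : ℝ ∂(MeasureTheory.volume.restrict (Set.Icc (-π) π)), t ≠ 0 :=
      MeasureTheory.ae_restrict_of_ae (MeasureTheory.Measure.ae_ne _ 0)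
    filter_upwards [h1, MeasureTheory.ae_restrict_mem measurableSet_Icc] with t ht ht'
    exact norm_dirichletSum_le_rpow m h0.le hε ht ht'.1 ht'.2
  rw [intervalIntegral.integral_const_mul, ← hI] at this
  refine this.trans ?_
  rw [mul_comm]; gcongr; linarith

/-! ### The Jackson kernel -/

lemma integral_normSq_dirichletSum (m : ℕ) :
    ∫ t in (-π)..π, ‖dirichletSum m t‖ ^ 2 = 2 * π * m := by
  have h : ∀ t : ℝ, ((‖dirichletSum m t‖ ^ 2 : ℝ) : ℂ) =
      ∑ k ∈ Finset.range m, ∑ l ∈ Finset.range m, trigMono ((k : ℤ) - l) t := by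
    intro t
    push_cast
    rw [← Complex.mul_conj', dirichletSum, Finset.sum_apply, map_sum, Finset.sum_mul_sum]
    refine Finset.sum_congr rfl fun k _ => Finset.sum_congr rfl fun l _ => ?_
    have := congrFun (star_trigMono (l : ℤ)) t
    rw [sub_eq_add_neg, ← trigMono_mul, ← star_trigMono]
    rfl
  have h2 : ((∫ t in (-π)..π, ‖dirichletSum m t‖ ^ 2 : ℝ) : ℂ) = ((2 * π * m : ℝ) : ℂ) := by
    rw [← intervalIntegral.integral_ofReal]
    simp_rw [h]
    rw [intervalIntegral.integral_finsetSum]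
    · have : ∀ k ∈ Finset.range m, ∫ t in (-π)..π, ∑ l ∈ Finset.range m, trigMono ((k : ℤ) - l) t
          = 2 * π := by
        intro k hk
        rw [intervalIntegral.integral_finsetSum]
        · simp_rw [integral_trigMono]
          rw [Finset.sum_eq_single k]
          · simp
          · intro l _ hl
            rw [if_neg]
            omega
          · intro h; exact absurd hk h
        · intro l _; exact Continuous.intervalIntegrable (by fun_prop) _ _
      rw [Finset.sum_congr rfl this]
      simp; ring
    · intro l _; exact Continuous.intervalIntegrable (by fun_prop) _ _
  exact_mod_cast h2

lemma norm_one_sub_trigMono_natCast_le (k : ℕ) (t : ℝ) : ‖1 - trigMono k t‖ ≤ k * |t| := by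
  have h := Complex.norm_exp_I_mul_ofReal_sub_one (k * t)
  have e : trigMono k t = Complex.exp (Complex.I * ((k * t : ℝ) : ℂ)) := by
    simp [trigMono, mul_comm]
  rw [norm_sub_rev, e, h, Real.norm_eq_abs, abs_mul]
  have := Real.abs_sin_le_abs (x := k * t / 2)
  rw [abs_div, abs_mul, Nat.abs_cast] at this
  norm_num at this ⊢
  linarith

lemma half_le_norm_dirichletSum {m : ℕ} (hm : 1 ≤ m) {t : ℝ} (ht : |t| ≤ 1 / m) :
    (m : ℝ) / 2 ≤ ‖dirichletSum m t‖ := by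
  have hm' : (0 : ℝ) < m := by exact_mod_cast hm
  have hsum : ∀ n : ℕ, ∑ k ∈ Finset.range n, (k : ℝ) ≤ n * n / 2 := by
    intro n
    induction n with
    | zero => simp
    | succ n ih => rw [Finset.sum_range_succ]; push_cast; nlinarith
  have h1 : ‖(m : ℂ) - dirichletSum m t‖ ≤ m / 2 := by
    have : (m : ℂ) - dirichletSum m t = ∑ k ∈ Finset.range m, (1 - trigMono k t) := by
      simp [dirichletSum]
    rw [this]
    calc _ ≤ ∑ k ∈ Finset.range m, ‖1 - trigMono k t‖ := norm_sum_le _ _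
      _ ≤ ∑ k ∈ Finset.range m, k * |t| :=
        Finset.sum_le_sum fun k _ => norm_one_sub_trigMono_natCast_le k t
      _ = (∑ k ∈ Finset.range m, (k : ℝ)) * |t| := by rw [Finset.sum_mul]
      _ ≤ (m * m / 2) * (1 / m) := by gcongr; exact hsum m
      _ = m / 2 := by field_simp
  have h2 := norm_sub_norm_le (m : ℂ) ((m : ℂ) - dirichletSum m t)
  rw [sub_sub_cancel, Complex.norm_natCast] at h2
  linarith

lemma integral_norm_dirichletSum_pow_four_ge {m : ℕ} (hm : 1 ≤ m) :
    (m : ℝ) ^ 3 / 8 ≤ ∫ t in (-π)..π, ‖dirichletSum m t‖ ^ 4 := by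
  have hm' : (1 : ℝ) ≤ m := by exact_mod_cast hm
  have hpi := Real.pi_gt_three
  have hle : 1 / (m : ℝ) ≤ 1 := by rw [div_le_one (by linarith)]; exact hm'
  have hpos : 0 < 1 / (m : ℝ) := by positivity
  have h1 : ∫ t in (-(1 / (m : ℝ)))..(1 / m), ‖dirichletSum m t‖ ^ 4 ≤
      ∫ t in (-π)..π, ‖dirichletSum m t‖ ^ 4 := by
    refine intervalIntegral.integral_mono_interval (by linarith) (by linarith) (by linarith)
      (Filter.Eventually.of_forall fun t => by positivity)
      (Continuous.intervalIntegrable (by fun_prop) _ _)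
  have h2 : ∫ t in (-(1 / (m : ℝ)))..(1 / m), ((m : ℝ) / 2) ^ 4 ≤
      ∫ t in (-(1 / (m : ℝ)))..(1 / m), ‖dirichletSum m t‖ ^ 4 := by
    refine intervalIntegral.integral_mono_on (by linarith)
      (by simp) (Continuous.intervalIntegrable (by fun_prop) _ _) fun t ht => ?_
    have := half_le_norm_dirichletSum hm (abs_le.2 ⟨ht.1, ht.2⟩)
    gcongr
  rw [intervalIntegral.integral_const, smul_eq_mul] at h2
  refine le_trans (le_of_eq ?_) (h2.trans h1)
  field_simp; ring

lemma integral_sq_mul_norm_dirichletSum_pow_four_le (m : ℕ) :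
    ∫ t in (-π)..π, t ^ 2 * ‖dirichletSum m t‖ ^ 4 ≤ 2 * π ^ 3 * m := by
  have hpi := Real.pi_pos
  have h : ∫ t in (-π)..π, t ^ 2 * ‖dirichletSum m t‖ ^ 4 ≤
      ∫ t in (-π)..π, π ^ 2 * ‖dirichletSum m t‖ ^ 2 := by
    refine intervalIntegral.integral_mono_on (by linarith)
      (Continuous.intervalIntegrable (by fun_prop) _ _)
      (Continuous.intervalIntegrable (by fun_prop) _ _) fun t ht => ?_
    have h1 := abs_mul_norm_dirichletSum_le m ht.1 ht.2
    have h2 : (|t| * ‖dirichletSum m t‖) ^ 2 ≤ π ^ 2 := by gcongr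
    calc t ^ 2 * ‖dirichletSum m t‖ ^ 4
        = (|t| * ‖dirichletSum m t‖) ^ 2 * ‖dirichletSum m t‖ ^ 2 := by
          rw [mul_pow, sq_abs]; ring
      _ ≤ _ := by gcongr
  rw [intervalIntegral.integral_const_mul, integral_normSq_dirichletSum] at h
  linarith

/-- A nonnegative trigonometric polynomial of degree `2m` and mass one whose second moment is
of order `m⁻²`. -/
structure IsJacksonKernel (C : ℝ) (m : ℕ) (K : ℝ → ℝ) : Prop where
  continuous : Continuous K
  nonneg : ∀ t, 0 ≤ K t
  mem_trigSpan : (fun t => (K t : ℂ)) ∈ trigSpan (-(2 * m)) (2 * m)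
  integral_eq_one : ∫ t in (-π)..π, K t = 1
  moment_le : ∫ t in (-π)..π, (1 + (m : ℝ) ^ 2 * t ^ 2) * K t ≤ C

lemma exists_jackson_kernel :
    ∃ C : ℝ, 0 < C ∧ ∀ m : ℕ, 1 ≤ m → ∃ K : ℝ → ℝ, IsJacksonKernel C m K := by
  have hpi := Real.pi_pos
  refine ⟨1 + 16 * π ^ 3, by positivity, fun m hm => ?_⟩
  have hm' : (1 : ℝ) ≤ m := by exact_mod_cast hm
  set I := ∫ t in (-π)..π, ‖dirichletSum m t‖ ^ 4 with hI
  have hIm : (m : ℝ) ^ 3 / 8 ≤ I := integral_norm_dirichletSum_pow_four_ge hm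
  have hI0 : 0 < I := lt_of_lt_of_le (by positivity) hIm
  refine ⟨fun t => I⁻¹ * ‖dirichletSum m t‖ ^ 4, by fun_prop, fun t => by positivity, ?_, ?_, ?_⟩
  · have h1 := dirichletSum_mem m
    have h2 := mul_mem_trigSpan h1 (star_mem_trigSpan h1)
    have h3 := Submodule.smul_mem _ ((I : ℂ)⁻¹) (mul_mem_trigSpan h2 h2)
    have h4 := trigSpan_mono (a' := -(2 * m)) (b' := 2 * m) (by omega) (by omega) h3
    convert h4 using 1
    funext t
    simp only [Pi.smul_apply, Pi.mul_apply, Pi.star_apply, smul_eq_mul]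
    push_cast
    rw [← starRingEnd_apply, Complex.mul_conj']
    ring
  · rw [intervalIntegral.integral_const_mul, ← hI]
    exact inv_mul_cancel₀ hI0.ne'
  · have e : ∀ t : ℝ, (1 + (m : ℝ) ^ 2 * t ^ 2) * (I⁻¹ * ‖dirichletSum m t‖ ^ 4) =
        I⁻¹ * ‖dirichletSum m t‖ ^ 4 + (m ^ 2 * I⁻¹) * (t ^ 2 * ‖dirichletSum m t‖ ^ 4) :=
      fun t => by ring
    simp_rw [e]
    rw [intervalIntegral.integral_add (Continuous.intervalIntegrable (by fun_prop) _ _)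
      (Continuous.intervalIntegrable (by fun_prop) _ _), intervalIntegral.integral_const_mul,
      intervalIntegral.integral_const_mul, ← hI, inv_mul_cancel₀ hI0.ne']
    refine add_le_add_right ?_ 1
    calc _ ≤ m ^ 2 * I⁻¹ * (2 * π ^ 3 * m) := by
          gcongr; exact integral_sq_mul_norm_dirichletSum_pow_four_le m
      _ = (m ^ 3 / I) * (2 * π ^ 3) := by field_simp
      _ ≤ 8 * (2 * π ^ 3) := by
          refine mul_le_mul_of_nonneg_right ?_ (by positivity)
          rw [div_le_iff₀ hI0]; linarith
      _ = _ := by ring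

/-! ### Jackson's theorem -/

/-- Periodic `β`-Hölder functions. -/
def PerHolder (β : ℝ) (f : ℝ → ℂ) : Prop :=
  Function.Periodic f (2 * π) ∧ ∃ C : ℝ, 0 ≤ C ∧ ∀ s t, ‖f t - f s‖ ≤ C * |t - s| ^ β

/-- Periodic functions that are `r` times differentiable, all of whose derivatives up to
order `r` are `β`-Hölder. -/
def PerHolderDiff (β : ℝ) : ℕ → (ℝ → ℂ) → Prop
  | 0, f => PerHolder β f
  | r + 1, f => PerHolder β f ∧ ∃ f' : ℝ → ℂ, (∀ t, HasDerivAt f (f' t) t) ∧ PerHolderDiff β r f'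

lemma PerHolder.continuous {β : ℝ} (hβ : 0 < β) {f : ℝ → ℂ} (hf : PerHolder β f) :
    Continuous f := by
  obtain ⟨_, C, hC, h⟩ := hf
  rw [continuous_iff_continuousAt]
  intro s
  rw [ContinuousAt, tendsto_iff_norm_sub_tendsto_zero]
  have : Filter.Tendsto (fun t : ℝ => C * |t - s| ^ β) (nhds s) (nhds 0) := by
    have hc : Continuous fun t : ℝ => C * |t - s| ^ β :=
      continuous_const.mul ((continuous_abs.comp (continuous_id.sub continuous_const)).rpow_const
        fun _ => Or.inr hβ.le)
    have := hc.tendsto s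
    simpa [Real.zero_rpow hβ.ne'] using this
  exact squeeze_zero (fun _ => norm_nonneg _) (fun t => h s t) this

lemma PerHolderDiff.perHolder {β : ℝ} {r : ℕ} {f : ℝ → ℂ} (hf : PerHolderDiff β r f) :
    PerHolder β f := by
  cases r with
  | zero => exact hf
  | succ r => exact hf.1

lemma exists_norm_le_of_periodic {f : ℝ → ℂ} (hf : Continuous f)
    (hp : Function.Periodic f (2 * π)) : ∃ M : ℝ, 0 ≤ M ∧ ∀ t, ‖f t‖ ≤ M := by
  obtain ⟨M, hM⟩ := (hp.isBounded_of_continuous Real.two_pi_pos.ne' hf).exists_norm_le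
  exact ⟨M, (norm_nonneg _).trans (hM _ ⟨0, rfl⟩), fun t => hM _ ⟨t, rfl⟩⟩

/-- Convolution of `f` with the kernel `K`. -/
noncomputable def convol (K : ℝ → ℝ) (f : ℝ → ℂ) : ℝ → ℂ :=
  fun x => ∫ t in (-π)..π, f (x - t) * K t

lemma convol_mem_trigSpan {C : ℝ} {m : ℕ} {K : ℝ → ℝ} (hK : IsJacksonKernel C m K)
    {f : ℝ → ℂ} (hf : Continuous f) (hp : Function.Periodic f (2 * π)) :
    convol K f ∈ trigSpan (-(2 * m)) (2 * m) := by
  have h := integral_mul_sub_mem_trigSpan hK.mem_trigSpan hf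
  convert h using 1
  funext x
  have hper : Function.Periodic (fun s => f s * (K (x - s) : ℂ)) (2 * π) := by
    intro s
    have h1 := periodic_of_mem_trigSpan hK.mem_trigSpan (x - (s + 2 * π))
    simp only [show x - (s + 2 * π) + 2 * π = x - s by ring] at h1
    simp only [hp s, h1]
  rw [← integral_comp_sub_periodic hper x]
  simp [convol]

lemma norm_sub_convol_le {C : ℝ} {m : ℕ} (hm : 1 ≤ m) {K : ℝ → ℝ} (hK : IsJacksonKernel C m K)
    {β : ℝ} (h0 : 0 < β) (h2 : β ≤ 2) {f : ℝ → ℂ} (hf : Continuous f) {H : ℝ} (hH : 0 ≤ H)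
    (hfH : ∀ s t, ‖f t - f s‖ ≤ H * |t - s| ^ β) (x : ℝ) :
    ‖f x - convol K f x‖ ≤ H * C * (m : ℝ) ^ (-β) := by
  have hpi := Real.pi_pos
  have hKc := hK.continuous
  have hm' : (0 : ℝ) < m := by exact_mod_cast hm
  have e : f x - convol K f x = ∫ t in (-π)..π, (f x - f (x - t)) * K t := by
    have h1 : f x = ∫ t in (-π)..π, f x * K t := by
      rw [intervalIntegral.integral_const_mul, intervalIntegral.integral_ofReal,
        hK.integral_eq_one]; simp
    conv_lhs => rw [h1, convol]
    rw [← intervalIntegral.integral_sub (Continuous.intervalIntegrable (by fun_prop) _ _)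
      (Continuous.intervalIntegrable (by fun_prop) _ _)]
    congr 1; funext t; ring
  have pw : ∀ t : ℝ, |t| ^ β ≤ (m : ℝ) ^ (-β) * (1 + (m : ℝ) ^ 2 * t ^ 2) := by
    intro t
    have h1 : (m * |t|) ^ β ≤ 1 + (m : ℝ) ^ 2 * t ^ 2 := by
      have hn : 0 ≤ m * |t| := by positivity
      rcases le_total (m * |t|) 1 with h | h
      · have := Real.rpow_le_one hn h h0.le
        have : 0 ≤ (m : ℝ) ^ 2 * t ^ 2 := by positivity
        linarith
      · have := Real.rpow_le_rpow_of_exponent_le h h2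
        rw [show (2 : ℝ) = ((2 : ℕ) : ℝ) by norm_num, Real.rpow_natCast, mul_pow, sq_abs] at this
        linarith
    rw [Real.mul_rpow hm'.le (abs_nonneg t)] at h1
    rw [Real.rpow_neg hm'.le, inv_mul_eq_div, le_div_iff₀ (by positivity)]
    linarith
  rw [e]
  calc ‖∫ t in (-π)..π, (f x - f (x - t)) * K t‖
      ≤ ∫ t in (-π)..π, ‖(f x - f (x - t)) * K t‖ :=
        intervalIntegral.norm_integral_le_integral_norm (by linarith)
    _ ≤ ∫ t in (-π)..π, H * (m : ℝ) ^ (-β) * ((1 + (m : ℝ) ^ 2 * t ^ 2) * K t) := by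
        refine intervalIntegral.integral_mono_on (by linarith)
          (Continuous.intervalIntegrable (by fun_prop) _ _)
          (Continuous.intervalIntegrable (by fun_prop) _ _) fun t _ => ?_
        have h1 := hfH (x - t) x
        rw [sub_sub_cancel] at h1
        have hKt := hK.nonneg t
        rw [norm_mul, Complex.norm_real, Real.norm_of_nonneg hKt, ← mul_assoc]
        refine mul_le_mul_of_nonneg_right (h1.trans ?_) hKt
        rw [mul_assoc]
        exact mul_le_mul_of_nonneg_left (pw t) hH
    _ ≤ H * (m : ℝ) ^ (-β) * C := by
        rw [intervalIntegral.integral_const_mul]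
        exact mul_le_mul_of_nonneg_left hK.moment_le (by positivity)
    _ = _ := by ring

lemma hasDerivAt_convol {C : ℝ} {m : ℕ} {K : ℝ → ℝ} (hK : IsJacksonKernel C m K)
    {f f' : ℝ → ℂ} (hf : ∀ t, HasDerivAt f (f' t) t) (hf' : Continuous f')
    (hp : Function.Periodic f' (2 * π)) (x : ℝ) :
    HasDerivAt (convol K f) (convol K f' x) x := by
  obtain ⟨M, hM, hb⟩ := exists_norm_le_of_periodic hf' hp
  have hKc := hK.continuous
  have hfc : Continuous f := continuous_iff_continuousAt.2 fun t => (hf t).continuousAt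
  refine (intervalIntegral.hasDerivAt_integral_of_dominated_loc_of_deriv_le
    (F := fun x t => f (x - t) * K t) (F' := fun x t => f' (x - t) * K t)
    (bound := fun t => M * K t) (s := Set.univ) Filter.univ_mem ?_ ?_ ?_ ?_ ?_ ?_).2
  · exact Filter.Eventually.of_forall fun y =>
      (by fun_prop : Continuous fun t => f (y - t) * (K t : ℂ)).aestronglyMeasurable
  · exact Continuous.intervalIntegrable (by fun_prop) _ _
  · exact (by fun_prop : Continuous fun t => f' (x - t) * (K t : ℂ)).aestronglyMeasurable
  · refine Filter.Eventually.of_forall fun t _ y _ => ?_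
    rw [norm_mul, Complex.norm_real, Real.norm_of_nonneg (hK.nonneg t)]
    exact mul_le_mul_of_nonneg_right (hb _) (hK.nonneg t)
  · exact Continuous.intervalIntegrable (by fun_prop) _ _
  · refine Filter.Eventually.of_forall fun t _ y _ => ?_
    exact ((hf (y - t)).comp_sub_const y t).mul_const _

/-- The error of approximation by convolution with `K`. -/
noncomputable def convolErr (K : ℝ → ℝ) (f : ℝ → ℂ) : ℝ → ℂ := f - convol K f

lemma convolErr_iterate_continuous {C : ℝ} {m : ℕ} {K : ℝ → ℝ} (hK : IsJacksonKernel C m K)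
    {f : ℝ → ℂ} (hf : Continuous f)
    (hp : Function.Periodic f (2 * π)) (k : ℕ) :
    Continuous ((convolErr K)^[k] f) ∧ Function.Periodic ((convolErr K)^[k] f) (2 * π) := by
  induction k with
  | zero => exact ⟨hf, hp⟩
  | succ k ih =>
    rw [Function.iterate_succ_apply']
    have h := convol_mem_trigSpan hK ih.1 ih.2
    exact ⟨ih.1.sub (continuous_of_mem_trigSpan h), ih.2.sub (periodic_of_mem_trigSpan h)⟩

lemma sub_convolErr_iterate_mem {C : ℝ} {m : ℕ} {K : ℝ → ℝ} (hK : IsJacksonKernel C m K)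
    {f : ℝ → ℂ} (hf : Continuous f)
    (hp : Function.Periodic f (2 * π)) (k : ℕ) :
    f - (convolErr K)^[k] f ∈ trigSpan (-(2 * m)) (2 * m) := by
  induction k with
  | zero => simp
  | succ k ih =>
    rw [Function.iterate_succ_apply']
    obtain ⟨h1, h2⟩ := convolErr_iterate_continuous hK hf hp k
    have := add_mem ih (convol_mem_trigSpan hK h1 h2)
    convert this using 1
    rw [convolErr]; abel

lemma hasDerivAt_convolErr_iterate {C : ℝ} {m : ℕ} {K : ℝ → ℝ} (hK : IsJacksonKernel C m K)
    {f f' : ℝ → ℂ} (hf : ∀ t, HasDerivAt f (f' t) t)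
    (hf' : Continuous f') (hp : Function.Periodic f' (2 * π)) (k : ℕ) (t : ℝ) :
    HasDerivAt ((convolErr K)^[k] f) ((convolErr K)^[k] f' t) t := by
  induction k generalizing t with
  | zero => exact hf t
  | succ k ih =>
    rw [Function.iterate_succ_apply', Function.iterate_succ_apply']
    obtain ⟨h1, h2⟩ := convolErr_iterate_continuous hK hf' hp k
    exact (ih t).sub (hasDerivAt_convol hK ih h1 h2 t)

lemma exists_norm_convolErr_iterate_le {β : ℝ} (h0 : 0 < β) (h1 : β ≤ 1) (C : ℝ) (hC : 0 < C)
    (r : ℕ) {f : ℝ → ℂ} (hf : PerHolderDiff β r f) :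
    ∃ B : ℝ, 0 ≤ B ∧ ∀ m : ℕ, 1 ≤ m → ∀ K : ℝ → ℝ, IsJacksonKernel C m K →
      ∀ x, ‖(convolErr K)^[r + 1] f x‖ ≤ B * (m : ℝ) ^ (-(r + β)) := by
  induction r generalizing f with
  | zero =>
    have hc := PerHolder.continuous h0 hf
    obtain ⟨hp, H, hH, hfH⟩ := hf
    refine ⟨H * C, by positivity, fun m hm K hK x => ?_⟩
    have := norm_sub_convol_le hm hK h0 (by linarith) hc hH hfH x
    simpa [convolErr] using this
  | succ r ih =>
    obtain ⟨hfh, f', hd, hf'⟩ := hf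
    obtain ⟨B, hB, hm⟩ := ih hf'
    refine ⟨B * C, by positivity, fun m hm1 K hK x => ?_⟩
    have hm' : (0 : ℝ) < m := by exact_mod_cast hm1
    have hf'c := hf'.perHolder.continuous h0
    set g := (convolErr K)^[r + 1] f with hg
    have hgd : ∀ t, HasDerivAt g ((convolErr K)^[r + 1] f' t) t := fun t =>
      hasDerivAt_convolErr_iterate hK hd hf'c hf'.perHolder.1 _ t
    have hgc : Continuous g := continuous_iff_continuousAt.2 fun t => (hgd t).continuousAt
    have hlip : ∀ s t, ‖g t - g s‖ ≤ B * (m : ℝ) ^ (-(r + β)) * |t - s| ^ (1 : ℝ) := by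
      intro s t
      rw [Real.rpow_one, ← Real.norm_eq_abs]
      exact Convex.norm_image_sub_le_of_norm_hasDerivWithin_le (s := Set.univ)
        (fun y _ => (hgd y).hasDerivWithinAt) (fun y _ => hm m hm1 K hK y) convex_univ
        (Set.mem_univ _) (Set.mem_univ _)
    have := norm_sub_convol_le hm1 hK one_pos (by norm_num) hgc (by positivity) hlip x
    rw [Function.iterate_succ_apply', ← hg]
    refine this.trans_eq ?_
    have e : (m : ℝ) ^ (-(((r + 1 : ℕ) : ℝ) + β)) = (m : ℝ) ^ (-(r + β)) * (m : ℝ) ^ (-(1 : ℝ)) := by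
      rw [← Real.rpow_add hm']; congr 1; push_cast; ring
    rw [e]; ring

/-- **Jackson's theorem**. -/
theorem exists_trigSpan_norm_sub_le {β : ℝ} (h0 : 0 < β) (h1 : β ≤ 1) (r : ℕ) {f : ℝ → ℂ}
    (hf : PerHolderDiff β r f) :
    ∃ B : ℝ, 0 ≤ B ∧ ∀ m : ℕ, 1 ≤ m → ∃ p ∈ trigSpan (-(2 * m)) (2 * m),
      ∀ x, ‖f x - p x‖ ≤ B * (m : ℝ) ^ (-(r + β)) := by
  obtain ⟨C, hC, hK⟩ := exists_jackson_kernel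
  obtain ⟨B, hB, h⟩ := exists_norm_convolErr_iterate_le h0 h1 C hC r hf
  refine ⟨B, hB, fun m hm => ?_⟩
  obtain ⟨K, hK⟩ := hK m hm
  refine ⟨f - (convolErr K)^[r + 1] f,
    sub_convolErr_iterate_mem hK (hf.perHolder.continuous h0) hf.perHolder.1 _, fun x => ?_⟩
  simpa using h m hm K hK x

/-! ### Spectral factorization near a constant -/

/-- The kernel of the projection onto nonnegative frequencies, with weight `1/2` at zero. -/
noncomputable def halfKernel (M : ℕ) : ℝ → ℂ := fun t => dirichletSum (M + 1) t - 1 / 2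

/-- The projection onto frequencies in `[0, M]`, with weight `1/2` at zero. -/
noncomputable def halfProj (M : ℕ) (q : ℝ → ℂ) : ℝ → ℂ :=
  fun x => (2 * π : ℂ)⁻¹ * ∫ s in (-π)..π, q s * halfKernel M (x - s)

lemma halfKernel_mem (M : ℕ) : halfKernel M ∈ trigSpan 0 M := by
  have h1 : dirichletSum (M + 1) ∈ trigSpan 0 M :=
    Submodule.sum_mem _ fun k hk => trigMono_mem ⟨by positivity, by
      have := Finset.mem_range.1 hk
      omega⟩
  exact sub_mem h1 (const_mem_trigSpan le_rfl (by positivity) (1 / 2))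

@[fun_prop]
lemma continuous_halfKernel (M : ℕ) : Continuous (halfKernel M) :=
  continuous_of_mem_trigSpan (halfKernel_mem M)

lemma halfProj_mem (M : ℕ) {q : ℝ → ℂ} (hq : Continuous q) : halfProj M q ∈ trigSpan 0 M :=
  Submodule.smul_mem _ _ (integral_mul_sub_mem_trigSpan (halfKernel_mem M) hq)

lemma halfProj_add (M : ℕ) {p q : ℝ → ℂ} (hp : Continuous p) (hq : Continuous q) :
    halfProj M (p + q) = halfProj M p + halfProj M q := by
  funext x
  simp only [halfProj, Pi.add_apply, add_mul, ← mul_add]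
  rw [← intervalIntegral.integral_add (Continuous.intervalIntegrable (by fun_prop) _ _)
      (Continuous.intervalIntegrable (by fun_prop) _ _)]

lemma halfProj_smul (M : ℕ) (c : ℂ) (q : ℝ → ℂ) :
    halfProj M (c • q) = c • halfProj M q := by
  funext x
  simp only [halfProj, Pi.smul_apply, smul_eq_mul, mul_assoc, intervalIntegral.integral_const_mul]
  ring

lemma norm_halfProj_le {M : ℕ} {L : ℝ} (hL : ∫ t in (-π)..π, ‖halfKernel M t‖ ≤ 2 * π * L)
    {q : ℝ → ℂ} (hq : Continuous q) {B : ℝ} (hB : ∀ s, ‖q s‖ ≤ B) (x : ℝ) :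
    ‖halfProj M q x‖ ≤ L * B := by
  have hpi := Real.pi_pos
  have hB0 : 0 ≤ B := (norm_nonneg _).trans (hB 0)
  have hper : Function.Periodic (fun t => ‖halfKernel M t‖) (2 * π) := fun t => by
    simp only [periodic_of_mem_trigSpan (halfKernel_mem M) t]
  have h : ‖∫ s in (-π)..π, q s * halfKernel M (x - s)‖ ≤ B * (2 * π * L) := by
    calc _ ≤ ∫ s in (-π)..π, ‖q s * halfKernel M (x - s)‖ :=
          intervalIntegral.norm_integral_le_integral_norm (by linarith)
      _ ≤ ∫ s in (-π)..π, B * ‖halfKernel M (x - s)‖ := by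
          refine intervalIntegral.integral_mono_on (by linarith)
            (Continuous.intervalIntegrable (by fun_prop) _ _)
            (Continuous.intervalIntegrable (by fun_prop) _ _) fun t _ => ?_
          rw [norm_mul]
          exact mul_le_mul_of_nonneg_right (hB t) (norm_nonneg _)
      _ = B * ∫ s in (-π)..π, ‖halfKernel M s‖ := by
          rw [intervalIntegral.integral_const_mul, integral_comp_sub_periodic hper x]
      _ ≤ _ := mul_le_mul_of_nonneg_left hL hB0
  rw [halfProj, norm_mul, norm_inv, norm_mul, Complex.norm_real, Real.norm_of_nonneg hpi.le]
  norm_num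
  calc π⁻¹ * (1 / 2) * ‖∫ s in (-π)..π, q s * halfKernel M (x - s)‖
      ≤ π⁻¹ * (1 / 2) * (B * (2 * π * L)) := by gcongr
    _ = L * B := by field_simp

lemma halfProj_trigMono (M : ℕ) (k : ℤ) : halfProj M (trigMono k) =
    ((if k ∈ Finset.Icc (0 : ℤ) M then (1 : ℂ) else 0) - (if k = 0 then 1 / 2 else 0)) •
      trigMono k := by
  funext x
  have hpi : (π : ℂ) ≠ 0 := by exact_mod_cast Real.pi_ne_zero
  have e1 : ∀ l : ℤ, ∫ s in (-π)..π, trigMono k s * trigMono l (x - s) =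
      if k = l then 2 * π * trigMono k x else 0 := by
    intro l
    have : ∀ s, trigMono k s * trigMono l (x - s) = trigMono l x * trigMono (k - l) s := by
      intro s
      rw [trigMono_sub_apply, sub_eq_add_neg, ← trigMono_mul, Pi.mul_apply]; ring
    simp_rw [this]
    rw [intervalIntegral.integral_const_mul, integral_trigMono]
    simp only [sub_eq_zero]
    split_ifs with h
    · rw [h]; ring
    · simp
  have e2 : ∀ s, trigMono k s * halfKernel M (x - s) =
      (∑ l ∈ Finset.range (M + 1), trigMono k s * trigMono l (x - s)) - trigMono k s * (1 / 2) := by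
    intro s
    rw [halfKernel, mul_sub, dirichletSum, Finset.sum_apply, Finset.mul_sum]
  simp only [halfProj, e2]
  rw [intervalIntegral.integral_sub, intervalIntegral.integral_finsetSum,
    intervalIntegral.integral_mul_const, integral_trigMono]
  rotate_left
  · intro l _; exact Continuous.intervalIntegrable (by fun_prop) _ _
  · exact Continuous.intervalIntegrable (by fun_prop) _ _
  · exact Continuous.intervalIntegrable (by fun_prop) _ _
  simp_rw [e1]
  have e3 : ∑ l ∈ Finset.range (M + 1), (if k = (l : ℤ) then 2 * π * trigMono k x else 0) =
      if k ∈ Finset.Icc (0 : ℤ) M then 2 * π * trigMono k x else 0 := by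
    split_ifs with h
    · rw [Finset.mem_Icc] at h
      rw [Finset.sum_eq_single k.toNat]
      · rw [if_pos (by omega)]
      · intro l _ hl; rw [if_neg (by omega)]
      · intro h'; exact absurd (Finset.mem_range.2 (by omega)) h'
    · refine Finset.sum_eq_zero fun l hl => if_neg ?_
      rintro rfl
      rw [Finset.mem_range] at hl
      exact h (Finset.mem_Icc.2 ⟨by omega, by omega⟩)
  rw [e3]
  simp only [Pi.smul_apply, smul_eq_mul]
  by_cases h0 : k = 0
  · subst h0
    simp [trigMono_zero]
    field_simp
  · simp only [h0, if_false]
    split_ifs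
    · field_simp; ring
    · simp

lemma halfProj_add_star {M : ℕ} {q : ℝ → ℂ} (hq : q ∈ trigSpan (-M) M) :
    halfProj M q + star (halfProj M (star q)) = q := by
  refine (trigSpan_induction (p := fun q => Continuous q ∧
    halfProj M q + star (halfProj M (star q)) = q) ?_ ?_ ?_ ?_ hq).2
  · rintro k ⟨hk1, hk2⟩
    refine ⟨continuous_trigMono k, ?_⟩
    rw [star_trigMono, halfProj_trigMono, halfProj_trigMono, star_smul, star_trigMono, neg_neg,
      ← add_smul]
    convert one_smul ℂ (trigMono k) using 2
    simp only [Finset.mem_Icc]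
    rcases lt_trichotomy k 0 with h | h | h
    · rw [if_neg (by omega), if_neg (by omega), if_pos (by omega), if_neg (by omega)]; simp
    · subst h; simp; norm_num
    · rw [if_pos (by omega), if_neg (by omega), if_neg (by omega), if_neg (by omega)]; simp
  · refine ⟨continuous_const, ?_⟩
    have : halfProj M 0 = 0 := by funext x; simp [halfProj]
    simp [this]
  · rintro f g ⟨hf, ef⟩ ⟨hg, eg⟩
    refine ⟨hf.add hg, ?_⟩
    rw [star_add, halfProj_add M hf hg, halfProj_add M (p := star f) (q := star g) hf.star hg.star,
      star_add]
    nth_rewrite 3 [← ef]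
    nth_rewrite 3 [← eg]
    abel
  · rintro c f ⟨hf, ef⟩
    refine ⟨hf.const_smul c, ?_⟩
    rw [star_smul, halfProj_smul, halfProj_smul, star_smul, star_star, ← smul_add, ef]

lemma exists_halfProj_fixedPoint {M : ℕ} {L η : ℝ} (hL0 : 0 < L) (hη : 0 ≤ η)
    (hLη : 8 * L ^ 2 * η ≤ 1)
    (hL : ∫ t in (-π)..π, ‖halfKernel M t‖ ≤ 2 * π * L)
    {h : ℝ → ℂ} (hh : Continuous h) (hb : ∀ x, ‖h x‖ ≤ η) :
    ∃ g : ℝ → ℂ, Continuous g ∧ (∀ x, ‖g x‖ ≤ 2 * L * η) ∧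
      halfProj M (fun x => h x - (‖g x‖ ^ 2 : ℝ)) = g := by
  set R := 2 * L * η with hR
  have hR0 : 0 ≤ R := by positivity
  have hc : ∀ g : BoundedContinuousFunction ℝ ℂ,
      Continuous (fun x => h x - ((‖g x‖ ^ 2 : ℝ) : ℂ)) := fun g => by
    have := g.continuous
    fun_prop
  have hbd : ∀ (g : BoundedContinuousFunction ℝ ℂ) (B : ℝ), ‖g‖ ≤ B →
      ∀ x, ‖halfProj M (fun x => h x - ((‖g x‖ ^ 2 : ℝ) : ℂ)) x‖ ≤ L * (η + B ^ 2) := by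
    intro g B hB x
    refine norm_halfProj_le hL (hc g) (fun s => (norm_sub_le _ _).trans (add_le_add (hb s) ?_)) x
    rw [Complex.norm_real, Real.norm_of_nonneg (by positivity)]
    have := (g.norm_coe_le_norm s).trans hB
    gcongr
  let Φ : BoundedContinuousFunction ℝ ℂ → BoundedContinuousFunction ℝ ℂ := fun g =>
    BoundedContinuousFunction.ofNormedAddCommGroup
      (halfProj M (fun x => h x - ((‖g x‖ ^ 2 : ℝ) : ℂ)))
      (continuous_of_mem_trigSpan (halfProj_mem M (hc g))) _ (hbd g ‖g‖ le_rfl)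
  have hmaps : Set.MapsTo Φ (Metric.closedBall 0 R) (Metric.closedBall 0 R) := by
    intro g hg
    rw [mem_closedBall_zero_iff] at hg ⊢
    rw [BoundedContinuousFunction.norm_le hR0]
    intro x
    refine (hbd g R hg x).trans ?_
    rw [hR]
    have : L * (η + (2 * L * η) ^ 2) = L * η * (1 + 4 * L ^ 2 * η) := by ring
    rw [this]
    have h4 : 4 * L ^ 2 * η ≤ 1 := by
      have : 0 ≤ 4 * L ^ 2 * η := by positivity
      linarith
    have h5 : 0 ≤ L * η := by positivity
    nlinarith
  have hcontr : ContractingWith (1 / 2) (hmaps.restrict Φ _ _) := by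
    refine ⟨by rw [← NNReal.coe_lt_coe]; norm_num, LipschitzWith.of_dist_le_mul ?_⟩
    rintro ⟨g, hg⟩ ⟨g', hg'⟩
    rw [mem_closedBall_zero_iff] at hg hg'
    rw [Subtype.dist_eq, Subtype.dist_eq, Set.MapsTo.val_restrict_apply,
      Set.MapsTo.val_restrict_apply]
    simp only
    rw [BoundedContinuousFunction.dist_le (by positivity)]
    intro x
    have e : Φ g x - Φ g' x = halfProj M (fun s => ((‖g' s‖ ^ 2 - ‖g s‖ ^ 2 : ℝ) : ℂ)) x := by
      have e1 : (fun x => h x - ((‖g x‖ ^ 2 : ℝ) : ℂ)) =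
          (fun x => h x - ((‖g' x‖ ^ 2 : ℝ) : ℂ)) +
            fun s => ((‖g' s‖ ^ 2 - ‖g s‖ ^ 2 : ℝ) : ℂ) := by
        funext s; simp
      have hcd : Continuous fun s => ((‖g' s‖ ^ 2 - ‖g s‖ ^ 2 : ℝ) : ℂ) := by
        have := g.continuous
        have := g'.continuous
        fun_prop
      have e2 := congrFun (halfProj_add M (hc g') hcd) x
      rw [← e1] at e2
      change halfProj M _ x - halfProj M _ x = _
      rw [e2, Pi.add_apply, add_sub_cancel_left]
    rw [dist_eq_norm, e]
    have hcd : Continuous fun s => ((‖g' s‖ ^ 2 - ‖g s‖ ^ 2 : ℝ) : ℂ) := by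
      have := g.continuous
      have := g'.continuous
      fun_prop
    refine (norm_halfProj_le hL hcd (B := 2 * R * dist g g') ?_ x).trans ?_
    · intro s
      rw [Complex.norm_real, Real.norm_eq_abs, sq_sub_sq, abs_mul]
      have h1 := (g.norm_coe_le_norm s).trans hg
      have h2 := (g'.norm_coe_le_norm s).trans hg'
      have h3 : |‖g' s‖ - ‖g s‖| ≤ dist g g' := by
        refine (abs_norm_sub_norm_le _ _).trans ?_
        rw [← dist_eq_norm, dist_comm]
        exact BoundedContinuousFunction.dist_coe_le_dist s
      rw [abs_of_nonneg (by positivity)]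
      gcongr
      linarith
    · have : L * (2 * R * dist g g') = (4 * L ^ 2 * η) * dist g g' := by rw [hR]; ring
      rw [this]
      push_cast
      gcongr
      linarith
  obtain ⟨g, hg, hfix, -⟩ := hcontr.exists_fixedPoint' Metric.isClosed_closedBall.isComplete hmaps
    (Metric.mem_closedBall_self hR0) (edist_ne_top _ _)
  rw [mem_closedBall_zero_iff] at hg
  refine ⟨g, g.continuous, fun x => (g.norm_coe_le_norm x).trans hg, ?_⟩
  funext x
  exact DFunLike.congr_fun hfix.eq x

/-- A real trigonometric polynomial close to `1` is the squared modulus of an analytic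
trigonometric polynomial close to `1`. -/
theorem exists_spectral_factor {M : ℕ} {L η : ℝ} (hL0 : 0 < L) (hη : 0 ≤ η)
    (hLη : 8 * L ^ 2 * η ≤ 1)
    (hL : ∫ t in (-π)..π, ‖halfKernel M t‖ ≤ 2 * π * L)
    {h : ℝ → ℂ} (hh : h ∈ trigSpan (-M) M) (hreal : star h = h) (hb : ∀ x, ‖h x‖ ≤ η) :
    ∃ g ∈ trigSpan 0 M, (∀ x, ‖g x‖ ≤ 2 * L * η) ∧
      ∀ x, (1 + g x) * star (1 + g x) = 1 + h x := by
  obtain ⟨g, hgc, hgb, hg⟩ :=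
    exists_halfProj_fixedPoint hL0 hη hLη hL (continuous_of_mem_trigSpan hh) hb
  have hmem : g ∈ trigSpan 0 M := by
    rw [← hg]
    refine halfProj_mem M ?_
    have := continuous_of_mem_trigSpan hh
    fun_prop
  refine ⟨g, hmem, hgb, fun x => ?_⟩
  have e : (fun x => h x - ((‖g x‖ ^ 2 : ℝ) : ℂ)) = h - g * star g := by
    funext y
    simp only [Pi.sub_apply, Pi.mul_apply, Pi.star_apply]
    rw [← starRingEnd_apply, Complex.mul_conj']
    push_cast; rfl
  rw [e] at hg
  have hq : h - g * star g ∈ trigSpan (-M) M := by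
    refine sub_mem hh ?_
    have := mul_mem_trigSpan hmem (star_mem_trigSpan hmem)
    simpa using this
  have h1 := halfProj_add_star hq
  have h2 : star (h - g * star g) = h - g * star g := by
    rw [star_sub, hreal, star_mul, star_star]
  rw [h2, hg] at h1
  have h3 := congrFun h1 x
  simp only [Pi.add_apply, Pi.star_apply, Pi.sub_apply, Pi.mul_apply] at h3
  rw [star_add, star_one]
  linear_combination h3

lemma exists_integral_norm_halfKernel_le {ε : ℝ} (h0 : 0 < ε) (hε : ε ≤ 1) :
    ∃ C : ℝ, 0 < C ∧ ∀ M : ℕ,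
      ∫ t in (-π)..π, ‖halfKernel M t‖ ≤ 2 * π * (C * ((M : ℝ) + 1) ^ ε) := by
  have hpi := Real.pi_pos
  obtain ⟨C, hC, h⟩ := exists_integral_norm_dirichletSum_le h0 hε
  refine ⟨C / (2 * π) + 1 / 2, by positivity, fun M => ?_⟩
  have h1 : ∫ t in (-π)..π, ‖halfKernel M t‖ ≤
      ∫ t in (-π)..π, (‖dirichletSum (M + 1) t‖ + 1 / 2) := by
    refine intervalIntegral.integral_mono_on (by linarith)
      (Continuous.intervalIntegrable (by fun_prop) _ _)
      (Continuous.intervalIntegrable (by fun_prop) _ _) fun t _ => ?_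
    refine (norm_sub_le _ _).trans (by norm_num)
  rw [intervalIntegral.integral_add (Continuous.intervalIntegrable (by fun_prop) _ _)
      (Continuous.intervalIntegrable (by fun_prop) _ _), intervalIntegral.integral_const] at h1
  have h2 := h (M + 1)
  push_cast at h2
  have h3 : 1 ≤ ((M : ℝ) + 1) ^ ε := Real.one_le_rpow (by linarith [M.cast_nonneg (α := ℝ)]) h0.le
  have h4 : 2 * π * ((C / (2 * π) + 1 / 2) * ((M : ℝ) + 1) ^ ε) =
      C * ((M : ℝ) + 1) ^ ε + π * ((M : ℝ) + 1) ^ ε := by field_simp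
  rw [h4]
  have h5 : π * 1 ≤ π * ((M : ℝ) + 1) ^ ε := by gcongr
  simp only [smul_eq_mul] at h1
  linarith

/-! ### Closure properties of periodic Hölder classes -/

lemma PerHolder.const {β : ℝ} (c : ℂ) : PerHolder β fun _ => c :=
  ⟨fun _ => rfl, 0, le_rfl, fun s t => by simp⟩

lemma PerHolder.add {β : ℝ} {f g : ℝ → ℂ} (hf : PerHolder β f) (hg : PerHolder β g) :
    PerHolder β fun t => f t + g t := by
  obtain ⟨pf, C, hC, hf⟩ := hf
  obtain ⟨pg, D, hD, hg⟩ := hg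
  refine ⟨fun t => by simp only [pf t, pg t], C + D, by positivity, fun s t => ?_⟩
  calc ‖f t + g t - (f s + g s)‖ = ‖(f t - f s) + (g t - g s)‖ := by congr 1; ring
    _ ≤ C * |t - s| ^ β + D * |t - s| ^ β := (norm_add_le _ _).trans (add_le_add (hf s t) (hg s t))
    _ = _ := by ring

lemma PerHolder.mul {β : ℝ} (hβ : 0 < β) {f g : ℝ → ℂ} (hf : PerHolder β f) (hg : PerHolder β g) :
    PerHolder β fun t => f t * g t := by
  obtain ⟨A, hA, hfA⟩ := exists_norm_le_of_periodic (hf.continuous hβ) hf.1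
  obtain ⟨B, hB, hgB⟩ := exists_norm_le_of_periodic (hg.continuous hβ) hg.1
  obtain ⟨pf, C, hC, hf⟩ := hf
  obtain ⟨pg, D, hD, hg⟩ := hg
  refine ⟨fun t => by simp only [pf t, pg t], C * B + A * D, by positivity, fun s t => ?_⟩
  calc ‖f t * g t - f s * g s‖ = ‖(f t - f s) * g t + f s * (g t - g s)‖ := by congr 1; ring
    _ ≤ ‖f t - f s‖ * ‖g t‖ + ‖f s‖ * ‖g t - g s‖ := by
        refine (norm_add_le _ _).trans ?_
        rw [norm_mul, norm_mul]
    _ ≤ (C * |t - s| ^ β) * B + A * (D * |t - s| ^ β) := by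
        gcongr
        exacts [hf s t, hgB t, hfA s, hg s t]
    _ = _ := by ring

lemma PerHolder.conj {β : ℝ} {f : ℝ → ℂ} (hf : PerHolder β f) :
    PerHolder β fun t => star (f t) := by
  obtain ⟨pf, C, hC, hf⟩ := hf
  refine ⟨fun t => by simp only [pf t], C, hC, fun s t => ?_⟩
  rw [← star_sub, norm_star]
  exact hf s t

lemma PerHolder.inv {β : ℝ} (hβ : 0 < β) {f : ℝ → ℂ} (hf : PerHolder β f) (h0 : ∀ t, f t ≠ 0) :
    PerHolder β fun t => (f t)⁻¹ := by
  have pi : Function.Periodic (fun t => (f t)⁻¹) (2 * π) := fun t => by simp only [hf.1 t]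
  obtain ⟨B, hB, hfB⟩ := exists_norm_le_of_periodic ((hf.continuous hβ).inv₀ h0) pi
  obtain ⟨pf, C, hC, hf⟩ := hf
  refine ⟨pi, B * C * B, by positivity, fun s t => ?_⟩
  calc ‖(f t)⁻¹ - (f s)⁻¹‖ = ‖(f t)⁻¹ * (f s - f t) * (f s)⁻¹‖ := by
        congr 1
        have := h0 s
        have := h0 t
        field_simp
    _ = ‖(f t)⁻¹‖ * ‖f s - f t‖ * ‖(f s)⁻¹‖ := by rw [norm_mul, norm_mul]
    _ ≤ B * (C * |t - s| ^ β) * B := by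
        gcongr
        exacts [hfB t, by rw [norm_sub_rev]; exact hf s t, hfB s]
    _ = _ := by ring

lemma PerHolder.sqrt {β : ℝ} (hβ : 0 < β) {ρ : ℝ → ℝ} (hf : PerHolder β fun t => (ρ t : ℂ))
    (h0 : ∀ t, 0 < ρ t) : PerHolder β fun t => ((√(ρ t) : ℝ) : ℂ) := by
  have pρ : Function.Periodic ρ (2 * π) := fun t =>
    Complex.ofReal_injective (hf.1 t)
  have cρ : Continuous ρ := by
    have := Complex.continuous_re.comp (hf.continuous hβ)
    exact this
  have pi : Function.Periodic (fun t => ((√(ρ t) : ℝ) : ℂ)⁻¹) (2 * π) := fun t => by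
    simp only [pρ t]
  have hs : ∀ t, 0 < √(ρ t) := fun t => Real.sqrt_pos.2 (h0 t)
  obtain ⟨B, hB, hfB⟩ := exists_norm_le_of_periodic
    ((Complex.continuous_ofReal.comp cρ.sqrt).inv₀ fun t => by
      simpa using (hs t).ne') pi
  obtain ⟨pf, C, hC, hf⟩ := hf
  refine ⟨fun t => by simp only [pρ t], C * B, by positivity, fun s t => ?_⟩
  have h1 : |√(ρ t) - √(ρ s)| * √(ρ t) ≤ |ρ t - ρ s| := by
    calc |√(ρ t) - √(ρ s)| * √(ρ t) ≤ |√(ρ t) - √(ρ s)| * (√(ρ t) + √(ρ s)) := by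
          gcongr; linarith [hs s]
      _ = |(√(ρ t) - √(ρ s)) * (√(ρ t) + √(ρ s))| := by
          rw [abs_mul, abs_of_pos (add_pos (hs t) (hs s))]
      _ = |√(ρ t) ^ 2 - √(ρ s) ^ 2| := by congr 1; ring
      _ = _ := by rw [Real.sq_sqrt (h0 t).le, Real.sq_sqrt (h0 s).le]
  have h2 := hf s t
  have h3 : (√(ρ t))⁻¹ ≤ B := by
    have : ‖((√(ρ t) : ℝ) : ℂ)⁻¹‖ ≤ B := hfB t
    rwa [norm_inv, Complex.norm_real, Real.norm_of_nonneg (hs t).le] at this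
  simp only [← Complex.ofReal_sub, Complex.norm_real, Real.norm_eq_abs] at h2 ⊢
  calc |√(ρ t) - √(ρ s)| = (|√(ρ t) - √(ρ s)| * √(ρ t)) * (√(ρ t))⁻¹ := by
        have := (hs t).ne'
        field_simp
    _ ≤ (C * |t - s| ^ β) * B := by
        exact mul_le_mul (h1.trans h2) h3 (inv_nonneg.2 (hs t).le) (by positivity)
    _ = _ := by ring

lemma PerHolderDiff.of_succ {β : ℝ} {r : ℕ} {f : ℝ → ℂ} (hf : PerHolderDiff β (r + 1) f) :
    PerHolderDiff β r f := by
  induction r generalizing f with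
  | zero => exact hf.1
  | succ r ih =>
    obtain ⟨h, f', hd, hf'⟩ := hf
    exact ⟨h, f', hd, ih hf'⟩

lemma PerHolderDiff.const {β : ℝ} (r : ℕ) (c : ℂ) : PerHolderDiff β r fun _ => c := by
  induction r generalizing c with
  | zero => exact PerHolder.const c
  | succ r ih => exact ⟨PerHolder.const c, fun _ => 0, fun t => hasDerivAt_const t c, ih 0⟩

lemma PerHolderDiff.add {β : ℝ} {r : ℕ} {f g : ℝ → ℂ} (hf : PerHolderDiff β r f)
    (hg : PerHolderDiff β r g) : PerHolderDiff β r fun t => f t + g t := by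
  induction r generalizing f g with
  | zero => exact PerHolder.add hf hg
  | succ r ih =>
    obtain ⟨h1, f', hd1, hf'⟩ := hf
    obtain ⟨h2, g', hd2, hg'⟩ := hg
    exact ⟨h1.add h2, _, fun t => (hd1 t).add (hd2 t), ih hf' hg'⟩

lemma PerHolderDiff.mul {β : ℝ} (hβ : 0 < β) {r : ℕ} {f g : ℝ → ℂ} (hf : PerHolderDiff β r f)
    (hg : PerHolderDiff β r g) : PerHolderDiff β r fun t => f t * g t := by
  induction r generalizing f g with
  | zero => exact PerHolder.mul hβ hf hg
  | succ r ih =>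
    have hf0 := hf.of_succ
    have hg0 := hg.of_succ
    obtain ⟨h1, f', hd1, hf'⟩ := hf
    obtain ⟨h2, g', hd2, hg'⟩ := hg
    exact ⟨h1.mul hβ h2, _, fun t => (hd1 t).mul (hd2 t), (ih hf' hg0).add (ih hf0 hg')⟩

lemma PerHolderDiff.neg {β : ℝ} (hβ : 0 < β) {r : ℕ} {f : ℝ → ℂ} (hf : PerHolderDiff β r f) :
    PerHolderDiff β r fun t => -f t := by
  simpa using (PerHolderDiff.const r (-1)).mul hβ hf

lemma PerHolderDiff.sub {β : ℝ} (hβ : 0 < β) {r : ℕ} {f g : ℝ → ℂ} (hf : PerHolderDiff β r f)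
    (hg : PerHolderDiff β r g) : PerHolderDiff β r fun t => f t - g t := by
  simpa only [sub_eq_add_neg] using hf.add (hg.neg hβ)

lemma PerHolderDiff.conj {β : ℝ} {r : ℕ} {f : ℝ → ℂ} (hf : PerHolderDiff β r f) :
    PerHolderDiff β r fun t => star (f t) := by
  induction r generalizing f with
  | zero => exact PerHolder.conj hf
  | succ r ih =>
    obtain ⟨h1, f', hd1, hf'⟩ := hf
    exact ⟨h1.conj, _, fun t => (hd1 t).star, ih hf'⟩

lemma PerHolderDiff.sum {β : ℝ} {r : ℕ} {ι : Type*} (s : Finset ι) {f : ι → ℝ → ℂ}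
    (hf : ∀ i ∈ s, PerHolderDiff β r (f i)) : PerHolderDiff β r fun t => ∑ i ∈ s, f i t := by
  classical
  induction s using Finset.induction_on with
  | empty => simpa using PerHolderDiff.const r 0
  | insert i s hi ih =>
    simp only [Finset.sum_insert hi]
    exact (hf i (by simp)).add (ih fun j hj => hf j (by simp [hj]))

lemma PerHolderDiff.inv {β : ℝ} (hβ : 0 < β) {r : ℕ} {f : ℝ → ℂ} (hf : PerHolderDiff β r f)
    (h0 : ∀ t, f t ≠ 0) : PerHolderDiff β r fun t => (f t)⁻¹ := by
  induction r with
  | zero => exact PerHolder.inv hβ hf h0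
  | succ r ih =>
    have hi := ih hf.of_succ
    obtain ⟨h1, f', hd1, hf'⟩ := hf
    refine ⟨h1.inv hβ h0, fun t => -f' t * ((f t)⁻¹ * (f t)⁻¹), fun t => ?_,
      (hf'.neg hβ).mul hβ (hi.mul hβ hi)⟩
    have := (hd1 t).fun_inv (h0 t)
    rwa [div_eq_mul_inv, sq, mul_inv] at this

lemma PerHolderDiff.div {β : ℝ} (hβ : 0 < β) {r : ℕ} {f g : ℝ → ℂ} (hf : PerHolderDiff β r f)
    (hg : PerHolderDiff β r g) (h0 : ∀ t, g t ≠ 0) : PerHolderDiff β r fun t => f t / g t := by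
  simpa only [div_eq_mul_inv] using hf.mul hβ (hg.inv hβ h0)

lemma PerHolderDiff.sqrt {β : ℝ} (hβ : 0 < β) {r : ℕ} {ρ : ℝ → ℝ}
    (hf : PerHolderDiff β r fun t => (ρ t : ℂ)) (h0 : ∀ t, 0 < ρ t) :
    PerHolderDiff β r fun t => ((√(ρ t) : ℝ) : ℂ) := by
  induction r with
  | zero => exact PerHolder.sqrt hβ hf h0
  | succ r ih =>
    have hi := ih hf.of_succ
    obtain ⟨h1, f', hd1, hf'⟩ := hf
    have hs : ∀ t, ((√(ρ t) : ℝ) : ℂ) ≠ 0 := fun t => by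
      simpa using (Real.sqrt_pos.2 (h0 t)).ne'
    refine ⟨h1.sqrt hβ h0, fun t => f' t / (2 * ((√(ρ t) : ℝ) : ℂ)), fun t => ?_,
      hf'.div hβ ((PerHolderDiff.const r 2).mul hβ hi) fun t => by simpa using hs t⟩
    have hre : HasDerivAt ρ (f' t).re t := by
      have := Complex.reCLM.hasFDerivAt.comp_hasDerivAt t (hd1 t)
      exact this
    have he : f' t = ((f' t).re : ℂ) := (hd1 t).unique hre.ofReal_comp
    convert (hre.sqrt (h0 t).ne').ofReal_comp using 1
    push_cast
    rw [← he]

lemma PerHolderDiff.re {β : ℝ} (hβ : 0 < β) {r : ℕ} {f : ℝ → ℂ} (hf : PerHolderDiff β r f) :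
    PerHolderDiff β r fun t => ((f t).re : ℂ) := by
  have := (PerHolderDiff.const r (1 / 2)).mul hβ (hf.add hf.conj)
  convert this using 2 with t
  rw [← starRingEnd_apply, Complex.add_conj]
  push_cast; ring

lemma PerHolderDiff.normSq {β : ℝ} (hβ : 0 < β) {r : ℕ} {f : ℝ → ℂ} (hf : PerHolderDiff β r f) :
    PerHolderDiff β r fun t => ((‖f t‖ ^ 2 : ℝ) : ℂ) := by
  convert hf.mul hβ hf.conj using 2 with t
  rw [← starRingEnd_apply, Complex.mul_conj']
  push_cast; rfl

lemma PerHolderDiff.norm {β : ℝ} (hβ : 0 < β) {r : ℕ} {f : ℝ → ℂ} (hf : PerHolderDiff β r f)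
    (h0 : ∀ t, f t ≠ 0) : PerHolderDiff β r fun t => (‖f t‖ : ℂ) := by
  have := (hf.normSq hβ).sqrt hβ fun t => by have := norm_pos_iff.2 (h0 t); positivity
  simpa only [Real.sqrt_sq (norm_nonneg _)] using this

lemma PerHolderDiff.continuous {β : ℝ} (hβ : 0 < β) {r : ℕ} {f : ℝ → ℂ}
    (hf : PerHolderDiff β r f) : Continuous f := hf.perHolder.continuous hβ

lemma PerHolderDiff.contDiff_one {β : ℝ} (hβ : 0 < β) {r : ℕ} {f : ℝ → ℂ}
    (hf : PerHolderDiff β (r + 1) f) : ContDiff ℝ 1 f := by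
  obtain ⟨_, f', hd, hf'⟩ := hf
  rw [contDiff_one_iff_deriv]
  refine ⟨fun t => (hd t).differentiableAt, ?_⟩
  rw [show deriv f = f' from funext fun t => (hd t).deriv]
  exact hf'.continuous hβ

/-- A periodic `C^r` function with Hölder `r`-th derivative belongs to the class. -/
lemma perHolderDiff_of_contDiff {β : ℝ} (h0 : 0 < β) (h1 : β ≤ 1) {r : ℕ} {f : ℝ → ℂ}
    (hp : Function.Periodic f (2 * π)) (hf : ContDiff ℝ r f) {C : ℝ} (hC : 0 ≤ C)
    (hh : ∀ s t, ‖iteratedDeriv r f t - iteratedDeriv r f s‖ ≤ C * |t - s| ^ β) :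
    PerHolderDiff β r f := by
  induction r generalizing f with
  | zero => exact ⟨hp, C, hC, by simpa using hh⟩
  | succ r ih =>
    have hf1 : ContDiff ℝ 1 f := hf.of_le (by norm_cast; omega)
    have hd : Differentiable ℝ f := hf1.differentiable (by simp)
    have hpd : Function.Periodic (deriv f) (2 * π) := fun t => by
      rw [← deriv_comp_add_const]
      congr 1
      exact funext hp
    have hdc : Continuous (deriv f) := (contDiff_one_iff_deriv.1 hf1).2
    obtain ⟨M, hM, hfM⟩ := exists_norm_le_of_periodic hd.continuous hp
    obtain ⟨D, hD, hfD⟩ := exists_norm_le_of_periodic hdc hpd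
    refine ⟨⟨hp, 2 * M + D, by positivity, fun s t => ?_⟩, deriv f, fun t => (hd t).hasDerivAt,
      ih hpd ?_ ?_⟩
    · have hl : ‖f t - f s‖ ≤ D * |t - s| := by
        have := convex_univ.norm_image_sub_le_of_norm_deriv_le (f := f) (x := s) (y := t)
          (fun x _ => hd x) (fun x _ => hfD x) (Set.mem_univ _) (Set.mem_univ _)
        simpa using this
      rcases le_total |t - s| 1 with h | h
      · have : |t - s| ≤ |t - s| ^ β := by
          rcases eq_or_lt_of_le (abs_nonneg (t - s)) with h' | h'
          · rw [← h', Real.zero_rpow h0.ne']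
          · simpa using Real.rpow_le_rpow_of_exponent_ge h' h h1
        calc ‖f t - f s‖ ≤ D * |t - s| := hl
          _ ≤ (2 * M + D) * |t - s| ^ β := by gcongr; linarith
      · have : 1 ≤ |t - s| ^ β := Real.one_le_rpow h h0.le
        calc ‖f t - f s‖ ≤ M + M := (norm_sub_le _ _).trans (add_le_add (hfM t) (hfM s))
          _ ≤ (2 * M + D) * 1 := by linarith
          _ ≤ (2 * M + D) * |t - s| ^ β := by gcongr
    · have : ContDiff ℝ ((r : WithTop ℕ∞) + 1) f := by exact_mod_cast hf
      exact (contDiff_succ_iff_deriv.1 this).2.2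
    · simpa only [iteratedDeriv_succ'] using hh

/-! ### Approximable loops -/

/-- Special unitary loops with entries in the periodic Hölder class that are approximable by
special unitary trigonometric polynomials at the rate `m ^ (-γ)`. -/
structure IsApproximable (β : ℝ) (r : ℕ) (γ : ℝ) {n : Type*} [Fintype n] [DecidableEq n]
    (U : ℝ → Matrix n n ℂ) : Prop where
  mem : ∀ t, U t ∈ Matrix.specialUnitaryGroup n ℂ
  diff : ∀ i j, PerHolderDiff β r fun t => U t i j
  approx : ∃ d : ℕ, ∃ C : ℝ, 0 ≤ C ∧ ∀ᶠ m : ℕ in Filter.atTop, ∃ P : ℝ → Matrix n n ℂ,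
    (∀ t, P t ∈ Matrix.specialUnitaryGroup n ℂ) ∧
    (∀ i j, (fun t => P t i j) ∈ trigSpan (-((d * m : ℕ) : ℤ)) ((d * m : ℕ) : ℤ)) ∧
    ∀ t i j, ‖U t i j - P t i j‖ ≤ C * (m : ℝ) ^ (-γ)

section

variable {n : Type*} [DecidableEq n] {β γ : ℝ} {r : ℕ}

/-! ### Embedding of `SU(2)` -/

/-- The matrix of the coordinate embedding given by `e`. -/
def coordIncl (e : Fin 2 → n) : Matrix n (Fin 2) ℂ := Matrix.of fun k p => if k = e p then 1 else 0

/-- The matrix acting as `A` on the coordinates `e 0, e 1` and trivially on the others. -/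
def embTwo (e : Fin 2 → n) (A : Matrix (Fin 2) (Fin 2) ℂ) : Matrix n n ℂ :=
  1 + coordIncl e * (A - 1) * (coordIncl e).transpose

lemma embTwo_one (e : Fin 2 → n) : embTwo e 1 = 1 := by simp [embTwo]

lemma embTwo_conjTranspose (e : Fin 2 → n) (A : Matrix (Fin 2) (Fin 2) ℂ) :
    (embTwo e A).conjTranspose = embTwo e A.conjTranspose := by
  have h : (coordIncl e).conjTranspose = (coordIncl e).transpose := by
    ext p k
    simp only [coordIncl, Matrix.conjTranspose_apply, Matrix.transpose_apply, Matrix.of_apply]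
    split_ifs <;> simp
  have h' : (coordIncl e).transpose.conjTranspose = coordIncl e := by
    rw [← h, Matrix.conjTranspose_conjTranspose]
  simp [embTwo, h, h', Matrix.mul_assoc]

lemma embTwo_apply (e : Fin 2 → n) (A : Matrix (Fin 2) (Fin 2) ℂ) (k l : n) :
    embTwo e A k l = (1 : Matrix n n ℂ) k l +
      ∑ p, ∑ q, (A p q - (1 : Matrix (Fin 2) (Fin 2) ℂ) p q) *
        (if k = e p ∧ l = e q then 1 else 0) := by
  simp only [embTwo, Matrix.add_apply, Matrix.mul_apply, coordIncl, Matrix.transpose_apply,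
    Matrix.of_apply, Matrix.sub_apply, Finset.sum_mul]
  rw [Finset.sum_comm]
  congr 1
  refine Finset.sum_congr rfl fun p _ => Finset.sum_congr rfl fun q _ => ?_
  by_cases h1 : k = e p <;> by_cases h2 : l = e q <;> simp [h1, h2]

variable [Fintype n]

lemma norm_entry_le_one {A : Matrix n n ℂ} (hA : A ∈ Matrix.specialUnitaryGroup n ℂ) (i j : n) :
    ‖A i j‖ ≤ 1 :=
  entry_norm_bound_of_unitary hA.1 i j

lemma conjTranspose_mem_specialUnitaryGroup {A : Matrix n n ℂ}
    (hA : A ∈ Matrix.specialUnitaryGroup n ℂ) : A.conjTranspose ∈ Matrix.specialUnitaryGroup n ℂ :=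
  (star (⟨A, hA⟩ : Matrix.specialUnitaryGroup n ℂ)).2

lemma IsApproximable.const {A : Matrix n n ℂ} (hA : A ∈ Matrix.specialUnitaryGroup n ℂ) :
    IsApproximable β r γ fun _ => A where
  mem _ := hA
  diff i j := PerHolderDiff.const r _
  approx := ⟨0, 0, le_rfl, Filter.Eventually.of_forall fun m => ⟨fun _ => A, fun _ => hA,
    fun i j => const_mem_trigSpan (by simp) (by simp) _, fun t i j => by simp⟩⟩

lemma IsApproximable.mul (hβ : 0 < β) {U V : ℝ → Matrix n n ℂ} (hU : IsApproximable β r γ U)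
    (hV : IsApproximable β r γ V) : IsApproximable β r γ fun t => U t * V t where
  mem t := mul_mem (hU.mem t) (hV.mem t)
  diff i j := by
    simp only [Matrix.mul_apply]
    exact PerHolderDiff.sum _ fun k _ => (hU.diff i k).mul hβ (hV.diff k j)
  approx := by
    obtain ⟨d, C, hC, h1⟩ := hU.approx
    obtain ⟨d', C', hC', h2⟩ := hV.approx
    refine ⟨d + d', Fintype.card n * (C + C'), by positivity, ?_⟩
    filter_upwards [h1, h2] with m ⟨P, hP, hPs, hPU⟩ ⟨Q, hQ, hQs, hQV⟩
    refine ⟨fun t => P t * Q t, fun t => mul_mem (hP t) (hQ t), fun i j => ?_, fun t i j => ?_⟩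
    · have : (fun t => (P t * Q t) i j) = ∑ k, (fun t => P t i k) * (fun t => Q t k j) := by
        funext t
        simp [Matrix.mul_apply]
      rw [this]
      refine Submodule.sum_mem _ fun k _ => ?_
      have := mul_mem_trigSpan (hPs i k) (hQs k j)
      convert this using 1
      push_cast
      congr 1 <;> ring
    · simp only [Matrix.mul_apply]
      rw [← Finset.sum_sub_distrib]
      calc ‖∑ k, (U t i k * V t k j - P t i k * Q t k j)‖
          ≤ ∑ _k : n, (C + C') * (m : ℝ) ^ (-γ) := by
            refine norm_sum_le_of_le _ fun k _ => ?_
            calc ‖U t i k * V t k j - P t i k * Q t k j‖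
                = ‖(U t i k - P t i k) * V t k j + P t i k * (V t k j - Q t k j)‖ := by
                  congr 1; ring
              _ ≤ ‖U t i k - P t i k‖ * ‖V t k j‖ + ‖P t i k‖ * ‖V t k j - Q t k j‖ := by
                  refine (norm_add_le _ _).trans ?_
                  rw [norm_mul, norm_mul]
              _ ≤ (C * (m : ℝ) ^ (-γ)) * 1 + 1 * (C' * (m : ℝ) ^ (-γ)) := by
                  gcongr
                  exacts [hPU t i k, norm_entry_le_one (hV.mem t) _ _,
                    norm_entry_le_one (hP t) _ _, hQV t k j]
              _ = _ := by ring
        _ = _ := by simp [mul_assoc]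

lemma IsApproximable.conjTranspose {U : ℝ → Matrix n n ℂ} (hU : IsApproximable β r γ U) :
    IsApproximable β r γ fun t => (U t).conjTranspose where
  mem t := conjTranspose_mem_specialUnitaryGroup (hU.mem t)
  diff i j := (hU.diff j i).conj
  approx := by
    obtain ⟨d, C, hC, h1⟩ := hU.approx
    refine ⟨d, C, hC, ?_⟩
    filter_upwards [h1] with m ⟨P, hP, hPs, hPU⟩
    refine ⟨fun t => (P t).conjTranspose,
      fun t => conjTranspose_mem_specialUnitaryGroup (hP t), fun i j => ?_, fun t i j => ?_⟩
    · have := star_mem_trigSpan (hPs j i)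
      rwa [neg_neg] at this
    · simp only [Matrix.conjTranspose_apply]
      rw [← star_sub, norm_star]
      exact hPU t j i

lemma coordIncl_transpose_mul {e : Fin 2 → n} (he : Function.Injective e) :
    (coordIncl e).transpose * coordIncl e = 1 := by
  ext p q
  simp [coordIncl, Matrix.mul_apply, Matrix.one_apply, he.eq_iff, eq_comm]

lemma embTwo_mul {e : Fin 2 → n} (he : Function.Injective e) (A B : Matrix (Fin 2) (Fin 2) ℂ) :
    embTwo e (A * B) = embTwo e A * embTwo e B := by
  have h : coordIncl e * (A - 1) * (coordIncl e).transpose *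
      (coordIncl e * (B - 1) * (coordIncl e).transpose) =
      coordIncl e * ((A - 1) * (B - 1)) * (coordIncl e).transpose := by
    calc _ = coordIncl e * (A - 1) * ((coordIncl e).transpose * coordIncl e) * (B - 1) *
          (coordIncl e).transpose := by simp only [Matrix.mul_assoc]
      _ = _ := by rw [coordIncl_transpose_mul he]; simp only [Matrix.mul_assoc, Matrix.one_mul]
  simp only [embTwo, add_mul, mul_add, one_mul, mul_one, h]
  rw [show A * B - 1 = (A - 1) + (B - 1) + (A - 1) * (B - 1) by noncomm_ring]
  simp only [Matrix.mul_add, Matrix.add_mul]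
  abel

lemma det_embTwo {e : Fin 2 → n} (he : Function.Injective e) (A : Matrix (Fin 2) (Fin 2) ℂ) :
    (embTwo e A).det = A.det := by
  rw [embTwo, Matrix.mul_assoc, Matrix.det_one_add_mul_comm, Matrix.mul_assoc,
    coordIncl_transpose_mul he]
  simp

lemma embTwo_mem {e : Fin 2 → n} (he : Function.Injective e) {A : Matrix (Fin 2) (Fin 2) ℂ}
    (hA : A ∈ Matrix.specialUnitaryGroup (Fin 2) ℂ) :
    embTwo e A ∈ Matrix.specialUnitaryGroup n ℂ := by
  rw [Matrix.mem_specialUnitaryGroup_iff, Matrix.mem_unitaryGroup_iff] at hA ⊢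
  refine ⟨?_, by rw [det_embTwo he, hA.2]⟩
  rw [Matrix.star_eq_conjTranspose] at hA ⊢
  rw [embTwo_conjTranspose, ← embTwo_mul he, hA.1, embTwo_one]

lemma IsApproximable.embTwo (hβ : 0 < β) {e : Fin 2 → n} (he : Function.Injective e)
    {U : ℝ → Matrix (Fin 2) (Fin 2) ℂ} (hU : IsApproximable β r γ U) :
    IsApproximable β r γ fun t => embTwo e (U t) where
  mem t := embTwo_mem he (hU.mem t)
  diff i j := by
    simp only [embTwo_apply]
    exact (PerHolderDiff.const r _).add <| PerHolderDiff.sum _ fun p _ => PerHolderDiff.sum _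
      fun q _ => ((hU.diff p q).sub hβ (PerHolderDiff.const r _)).mul hβ (PerHolderDiff.const r _)
  approx := by
    obtain ⟨d, C, hC, h1⟩ := hU.approx
    refine ⟨d, 4 * C, by positivity, ?_⟩
    filter_upwards [h1] with m ⟨P, hP, hPs, hPU⟩
    refine ⟨fun t => _root_.embTwo e (P t), fun t => embTwo_mem he (hP t), fun i j => ?_,
      fun t i j => ?_⟩
    · have hc : ∀ c : ℂ, (fun _ : ℝ => c) ∈ trigSpan (-((d * m : ℕ) : ℤ)) ((d * m : ℕ) : ℤ) :=
        fun c => const_mem_trigSpan (neg_nonpos.2 (Int.natCast_nonneg _)) (Int.natCast_nonneg _) c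
      have : (fun t => _root_.embTwo e (P t) i j) = (fun _ => (1 : Matrix n n ℂ) i j) +
          ∑ p, ∑ q, (if i = e p ∧ j = e q then (1 : ℂ) else 0) •
            ((fun t => P t p q) - fun _ => (1 : Matrix (Fin 2) (Fin 2) ℂ) p q) := by
        funext t
        simp only [embTwo_apply, Pi.add_apply, Finset.sum_apply, Pi.smul_apply, Pi.sub_apply,
          smul_eq_mul, mul_comm]
      rw [this]
      exact add_mem (hc _) (sum_mem fun p _ => sum_mem fun q _ =>
        Submodule.smul_mem _ _ (sub_mem (hPs p q) (hc _)))
    · simp only [embTwo_apply]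
      rw [add_sub_add_left_eq_sub, ← Finset.sum_sub_distrib]
      simp only [← Finset.sum_sub_distrib, ← sub_mul, sub_sub_sub_cancel_right]
      calc _ ≤ ∑ _p : Fin 2, ∑ _q : Fin 2, C * (m : ℝ) ^ (-γ) := by
            refine norm_sum_le_of_le _ fun p _ => norm_sum_le_of_le _ fun q _ => ?_
            split_ifs
            · simpa using hPU t p q
            · simp; positivity
        _ = _ := by simp; ring

lemma embTwo_mulVec_apply (e : Fin 2 → n) (A : Matrix (Fin 2) (Fin 2) ℂ) (u : n → ℂ) (k : n) :
    (embTwo e A).mulVec u k =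
      u k + ∑ p, (if k = e p then (A.mulVec (u ∘ e) p - u (e p)) else 0) := by
  have h : (coordIncl e).transpose.mulVec u = u ∘ e := by
    funext p
    simp [coordIncl, Matrix.mulVec, dotProduct]
  rw [embTwo, Matrix.add_mulVec, Matrix.one_mulVec, ← Matrix.mulVec_mulVec, h,
    ← Matrix.mulVec_mulVec, Pi.add_apply, Matrix.sub_mulVec, Matrix.one_mulVec]
  congr 1
  simp [coordIncl, Matrix.mulVec, dotProduct]

end

/-! ### Approximable loops in `SU(2)` -/

/-- The matrix `(a, b; -b̄, ā)`. -/
def suTwo (a b : ℂ) : Matrix (Fin 2) (Fin 2) ℂ := !![a, b; -star b, star a]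

/-- The complex number `1 / √2`. -/
noncomputable def rootHalf : ℂ := ((√2 : ℝ) : ℂ)⁻¹

lemma rootHalf_mul_self : rootHalf * rootHalf = 1 / 2 := by
  rw [rootHalf, ← mul_inv, ← Complex.ofReal_mul, Real.mul_self_sqrt (by norm_num)]
  norm_num

lemma norm_rootHalf_le : ‖rootHalf‖ ≤ 1 := by
  rw [rootHalf, norm_inv, Complex.norm_real, Real.norm_of_nonneg (by positivity)]
  exact inv_le_one_of_one_le₀ (Real.one_le_sqrt.2 (by norm_num))

lemma star_rootHalf : star rootHalf = rootHalf := by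
  rw [rootHalf, star_inv₀, ← starRingEnd_apply, Complex.conj_ofReal]

lemma suTwo_mul (a b c d : ℂ) :
    suTwo a b * suTwo c d = suTwo (a * c - b * star d) (a * d + b * star c) := by
  ext i j
  fin_cases i <;> fin_cases j <;> simp [suTwo, Matrix.mul_apply] <;> ring

lemma suTwo_mem {a b : ℂ} (h : a * star a + b * star b = 1) :
    suTwo a b ∈ Matrix.specialUnitaryGroup (Fin 2) ℂ := by
  rw [Matrix.mem_specialUnitaryGroup_iff, Matrix.mem_unitaryGroup_iff]
  have h' : b * star b + a * star a = 1 := by rw [← h]; ring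
  simp only [← starRingEnd_apply] at h h'
  constructor
  · ext i j
    fin_cases i <;> fin_cases j <;>
      simp [suTwo, Matrix.mul_apply, Matrix.star_eq_conjTranspose]
    · exact h
    · ring
    · ring
    · linear_combination h'
  · simp [suTwo, Matrix.det_fin_two]
    exact h

section

variable {β γ : ℝ} {r : ℕ}

lemma perHolderDiff_suTwo (hβ : 0 < β) {a b : ℝ → ℂ} (ha : PerHolderDiff β r a)
    (hb : PerHolderDiff β r b) (i j : Fin 2) : PerHolderDiff β r fun t => suTwo (a t) (b t) i j := by
  fin_cases i <;> fin_cases j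
  exacts [ha, hb, hb.conj.neg hβ, ha.conj]

lemma norm_suTwo_sub_le {a b c d : ℂ} {B : ℝ} (h1 : ‖a - c‖ ≤ B) (h2 : ‖b - d‖ ≤ B)
    (i j : Fin 2) : ‖suTwo a b i j - suTwo c d i j‖ ≤ B := by
  have h3 : ‖star a - star c‖ ≤ B := by rwa [← star_sub, norm_star]
  have h4 : ‖-star b - -star d‖ ≤ B := by rwa [← neg_sub', norm_neg, ← star_sub, norm_star]
  fin_cases i <;> fin_cases j
  exacts [h1, h2, h4, h3]

lemma suTwo_mem_trigSpan {a b : ℝ → ℂ} {k : ℤ} (ha : a ∈ trigSpan (-k) k)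
    (hb : b ∈ trigSpan (-k) k) (i j : Fin 2) :
    (fun t => suTwo (a t) (b t) i j) ∈ trigSpan (-k) k := by
  have has := star_mem_trigSpan ha
  have hbs := star_mem_trigSpan hb
  rw [neg_neg] at has hbs
  fin_cases i <;> fin_cases j
  exacts [ha, hb, neg_mem hbs, has]

/-- Exponents `γ` slightly below the smoothness `r + β`. -/
structure IsAdmissibleRate (β : ℝ) (r : ℕ) (γ : ℝ) : Prop where
  pos : 0 < β
  le_one : β ≤ 1
  lt : γ < r + β
  le_add_one : r + β ≤ γ + 1
  lt_two_mul : r + β < 2 * γ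

/-- The basic approximable loop, for a unimodular function `f`. -/
lemma isApproximable_suTwo_const (hr : IsAdmissibleRate β r γ) {f : ℝ → ℂ}
    (hf : PerHolderDiff β r f) (hf1 : ∀ t, ‖f t‖ = 1) :
    IsApproximable β r γ fun t => suTwo (f t * rootHalf) rootHalf := by
  obtain ⟨hβ, hβ1, h1, h2, h3⟩ := hr
  have hunit : ∀ a b : ℂ, a * star a + b * star b = 2 →
      suTwo (a * rootHalf) (b * rootHalf) ∈ Matrix.specialUnitaryGroup (Fin 2) ℂ := by
    intro a b h
    refine suTwo_mem ?_
    simp only [star_mul, star_rootHalf]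
    linear_combination (rootHalf * rootHalf) * h + 2 * rootHalf_mul_self
  have hff : ∀ t, f t * star (f t) = 1 := fun t => by
    rw [← starRingEnd_apply, Complex.mul_conj', hf1]; norm_num
  refine ⟨fun t => ?_, perHolderDiff_suTwo hβ (hf.mul hβ (PerHolderDiff.const r _))
    (PerHolderDiff.const r _), ?_⟩
  · have := hunit (f t) 1 (by rw [hff]; norm_num)
    rwa [one_mul] at this
  obtain ⟨B, hB, hJ⟩ := exists_trigSpan_norm_sub_le hβ hβ1 r hf
  obtain ⟨C, hC, hK⟩ := exists_integral_norm_halfKernel_le (ε := r + β - γ) (by linarith)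
    (by linarith)
  set a : ℝ := r + β with ha
  set C' : ℝ := C * 5 ^ (a - γ) with hC'
  have hC'0 : 0 < C' := by positivity
  refine ⟨4, B + 2 * C' * (B * (2 + B)), by positivity, ?_⟩
  have hlim : Filter.Tendsto (fun m : ℕ => 8 * C' ^ 2 * (B * (2 + B)) * (m : ℝ) ^ (-(2 * γ - a)))
      Filter.atTop (nhds 0) := by
    have := ((tendsto_rpow_neg_atTop (y := 2 * γ - a) (by linarith)).comp
      tendsto_natCast_atTop_atTop).const_mul (8 * C' ^ 2 * (B * (2 + B)))
    simpa using this
  filter_upwards [Filter.eventually_ge_atTop 1, hlim.eventually_le_const one_pos] with m hm hm1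
  have hm0 : (0 : ℝ) < m := by exact_mod_cast hm
  have hm1' : (1 : ℝ) ≤ m := by exact_mod_cast hm
  obtain ⟨p, hp, hpf⟩ := hJ m hm
  have hma : (m : ℝ) ^ (-a) ≤ 1 := Real.rpow_le_one_of_one_le_of_nonpos hm1' (by linarith)
  have hmag : (m : ℝ) ^ (-a) ≤ (m : ℝ) ^ (-γ) :=
    Real.rpow_le_rpow_of_exponent_le hm1' (by linarith)
  set η : ℝ := B * (2 + B) * (m : ℝ) ^ (-a) with hη
  set L : ℝ := C' * (m : ℝ) ^ (a - γ) with hL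
  have hL0 : 0 < L := by positivity
  have hLη : L * η = C' * (B * (2 + B)) * (m : ℝ) ^ (-γ) := by
    rw [show -γ = (a - γ) + -a by ring, Real.rpow_add hm0]
    ring
  have hLLη : 8 * L ^ 2 * η ≤ 1 := by
    refine le_trans (le_of_eq ?_) hm1
    rw [show -(2 * γ - a) = (a - γ) + -γ by ring, Real.rpow_add hm0]
    calc 8 * L ^ 2 * η = 8 * L * (L * η) := by ring
      _ = _ := by rw [hLη, hL]; ring
  have hLint : ∫ t in (-π)..π, ‖halfKernel (4 * m) t‖ ≤ 2 * π * L := by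
    refine (hK (4 * m)).trans ?_
    have : ((4 * m : ℕ) : ℝ) + 1 ≤ 5 * m := by push_cast; linarith
    have h5 : (((4 * m : ℕ) : ℝ) + 1) ^ (a - γ) ≤ 5 ^ (a - γ) * (m : ℝ) ^ (a - γ) := by
      rw [← Real.mul_rpow (by norm_num) hm0.le]
      exact Real.rpow_le_rpow (by positivity) this (by linarith)
    rw [hL, hC', mul_assoc C]
    gcongr
  have hp4 : p ∈ trigSpan (-((4 * m : ℕ) : ℤ)) ((4 * m : ℕ) : ℤ) :=
    trigSpan_mono (by push_cast; omega) (by push_cast; omega) hp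
  have hone : (fun _ : ℝ => (1 : ℂ)) ∈ trigSpan (-((4 * m : ℕ) : ℤ)) ((4 * m : ℕ) : ℤ) :=
    const_mem_trigSpan (by omega) (by omega) 1
  have hh : (fun _ => 1) - p * star p ∈ trigSpan (-((4 * m : ℕ) : ℤ)) ((4 * m : ℕ) : ℤ) := by
    refine sub_mem hone ?_
    have := mul_mem_trigSpan hp (star_mem_trigSpan hp)
    exact trigSpan_mono (by push_cast; omega) (by push_cast; omega) this
  have hreal : star ((fun _ => 1) - p * star p) = (fun _ => 1) - p * star p := by
    funext x
    simp only [Pi.star_apply, Pi.sub_apply, Pi.mul_apply, star_sub, star_one, star_mul, star_star]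
  have hb : ∀ x, ‖((fun _ => 1) - p * star p : ℝ → ℂ) x‖ ≤ η := by
    intro x
    have hd : ‖f x - p x‖ ≤ B * (m : ℝ) ^ (-a) := hpf x
    have hp1 : ‖star (p x)‖ ≤ 1 + B := by
      rw [norm_star]
      calc ‖p x‖ = ‖f x - (f x - p x)‖ := by rw [sub_sub_cancel]
        _ ≤ ‖f x‖ + ‖f x - p x‖ := norm_sub_le _ _
        _ ≤ 1 + B * 1 := by rw [hf1]; gcongr; exact hd.trans (by gcongr)
        _ = _ := by ring
    have e : ((fun _ => 1) - p * star p : ℝ → ℂ) x =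
        f x * star (f x - p x) + (f x - p x) * star (p x) := by
      simp only [Pi.sub_apply, Pi.mul_apply, Pi.star_apply, star_sub]
      linear_combination -(hff x)
    rw [e]
    calc _ ≤ ‖f x‖ * ‖f x - p x‖ + ‖f x - p x‖ * ‖star (p x)‖ := by
          refine (norm_add_le _ _).trans ?_
          rw [norm_mul, norm_mul, norm_star (f x - p x)]
      _ ≤ 1 * (B * (m : ℝ) ^ (-a)) + (B * (m : ℝ) ^ (-a)) * (1 + B) := by
          rw [hf1]
          gcongr
      _ = η := by rw [hη]; ring
  obtain ⟨g, hg, hgb, hgf⟩ := exists_spectral_factor hL0 (by positivity) hLLη hLint hh hreal hb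
  refine ⟨fun t => suTwo (p t * rootHalf) ((1 + g t) * rootHalf), fun t => ?_, ?_, ?_⟩
  · refine hunit _ _ ?_
    rw [hgf t]
    simp only [Pi.sub_apply, Pi.mul_apply, Pi.star_apply]
    ring
  · have hg4 : g ∈ trigSpan (-((4 * m : ℕ) : ℤ)) ((4 * m : ℕ) : ℤ) :=
      trigSpan_mono (by omega) le_rfl hg
    refine suTwo_mem_trigSpan ?_ ?_
    · have := Submodule.smul_mem _ rootHalf hp4
      convert this using 1
      funext t
      simp [mul_comm]
    · have := Submodule.smul_mem _ rootHalf (add_mem hone hg4)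
      convert this using 1
      funext t
      simp [mul_comm]
  · intro t
    have e : (B + 2 * C' * (B * (2 + B))) * (m : ℝ) ^ (-γ) =
        B * (m : ℝ) ^ (-γ) + 2 * (L * η) := by rw [hLη]; ring
    rw [e]
    have hη0 : 0 ≤ η := by positivity
    refine norm_suTwo_sub_le ?_ ?_
    · rw [← sub_mul, norm_mul]
      calc _ ≤ (B * (m : ℝ) ^ (-a)) * 1 := by
            gcongr
            exacts [hpf t, norm_rootHalf_le]
        _ ≤ B * (m : ℝ) ^ (-γ) := by rw [mul_one]; gcongr
        _ ≤ _ := le_add_of_nonneg_right (by positivity)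
    · rw [show rootHalf - (1 + g t) * rootHalf = -g t * rootHalf by ring,
        norm_mul, norm_neg]
      calc _ ≤ (2 * L * η) * 1 := by
            gcongr
            exacts [hgb t, norm_rootHalf_le]
        _ = 2 * (L * η) := by ring
        _ ≤ _ := le_add_of_nonneg_left (by positivity)

end

lemma star_I : star Complex.I = -Complex.I := Complex.conj_I

lemma star_ofReal (x : ℝ) : star (x : ℂ) = x := Complex.conj_ofReal x

section

variable {β γ : ℝ} {r : ℕ}

lemma isApproximable_suTwo_diag (hr : IsAdmissibleRate β r γ) {f : ℝ → ℂ}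
    (hf : PerHolderDiff β r f) (hf1 : ∀ t, ‖f t‖ = 1) :
    IsApproximable β r γ fun t => suTwo (f t) 0 := by
  have hJ : suTwo 0 (-1) ∈ Matrix.specialUnitaryGroup (Fin 2) ℂ := suTwo_mem (by simp)
  have h := ((isApproximable_suTwo_const hr hf hf1).mul hr.pos
    (isApproximable_suTwo_const hr hf.conj fun t => by rw [norm_star, hf1])).mul hr.pos
    (IsApproximable.const hJ)
  convert h using 2 with t
  have hff : f t * star (f t) = 1 := by
    rw [← starRingEnd_apply, Complex.mul_conj', hf1]; norm_num
  rw [suTwo_mul, suTwo_mul]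
  simp only [star_mul, star_star, star_rootHalf, star_neg, star_one, star_zero]
  congr 1
  · linear_combination (-2 * f t) * rootHalf_mul_self
  · linear_combination (rootHalf * rootHalf) * hff

lemma isApproximable_suTwo_rotation (hr : IsAdmissibleRate β r γ) {c s : ℝ → ℝ}
    (hc : PerHolderDiff β r fun t => (c t : ℂ)) (hs : PerHolderDiff β r fun t => (s t : ℂ))
    (hcs : ∀ t, c t ^ 2 + s t ^ 2 = 1) {ω : ℂ} (hω : ω * star ω = 1) :
    IsApproximable β r γ fun t => suTwo (c t) (ω * s t) := by
  have hQ : suTwo rootHalf (Complex.I * ω * rootHalf) ∈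
      Matrix.specialUnitaryGroup (Fin 2) ℂ := by
    refine suTwo_mem ?_
    simp only [star_mul, star_rootHalf, star_I]
    linear_combination (rootHalf * rootHalf) * hω + 2 * rootHalf_mul_self -
      (ω * star ω * rootHalf * rootHalf) * Complex.I_mul_I
  have hu : PerHolderDiff β r fun t => (c t : ℂ) + Complex.I * s t :=
    hc.add ((PerHolderDiff.const r _).mul hr.pos hs)
  have hu1 : ∀ t, ‖(c t : ℂ) + Complex.I * s t‖ = 1 := fun t => by
    rw [mul_comm, Complex.norm_add_mul_I, hcs, Real.sqrt_one]
  have h := ((IsApproximable.const hQ).mul hr.pos (isApproximable_suTwo_diag hr hu hu1)).mul hr.pos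
    (IsApproximable.const (conjTranspose_mem_specialUnitaryGroup hQ))
  convert h using 2 with t
  have hT : (suTwo rootHalf (Complex.I * ω * rootHalf)).conjTranspose =
      suTwo rootHalf (-(Complex.I * ω * rootHalf)) := by
    ext i j
    fin_cases i <;> fin_cases j <;> simp [suTwo, Matrix.conjTranspose_apply, ← starRingEnd_apply]
    · exact star_rootHalf
    · exact star_rootHalf.symm
  rw [hT, suTwo_mul, suTwo_mul]
  have h2 := rootHalf_mul_self
  simp only [star_mul, star_neg, star_add, star_rootHalf, star_zero, star_I, star_ofReal]
  congr 1
  · linear_combination (-2 * (c t : ℂ)) * h2 +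
      (rootHalf ^ 2 * (c t - Complex.I * s t) * Complex.I ^ 2) * hω +
      (rootHalf ^ 2 * (c t - Complex.I * s t)) * Complex.I_mul_I
  · linear_combination (2 * Complex.I ^ 2 * ω * s t) * h2 + (ω * s t) * Complex.I_mul_I

lemma PerHolderDiff.im (hβ : 0 < β) {f : ℝ → ℂ} (hf : PerHolderDiff β r f) :
    PerHolderDiff β r fun t => ((f t).im : ℂ) := by
  simpa using ((PerHolderDiff.const r (-Complex.I)).mul hβ hf).re hβ

end

section

variable {β γ : ℝ} {r : ℕ}

lemma PerHolderDiff.ofReal_add {f g : ℝ → ℝ}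
    (hf : PerHolderDiff β r fun t => (f t : ℂ)) (hg : PerHolderDiff β r fun t => (g t : ℂ)) :
    PerHolderDiff β r fun t => ((f t + g t : ℝ) : ℂ) := by
  simpa only [Complex.ofReal_add] using hf.add hg

lemma PerHolderDiff.ofReal_mul (hβ : 0 < β) {f g : ℝ → ℝ}
    (hf : PerHolderDiff β r fun t => (f t : ℂ)) (hg : PerHolderDiff β r fun t => (g t : ℂ)) :
    PerHolderDiff β r fun t => ((f t * g t : ℝ) : ℂ) := by
  simpa only [Complex.ofReal_mul] using hf.mul hβ hg

lemma PerHolderDiff.ofReal_div (hβ : 0 < β) {f g : ℝ → ℝ}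
    (hf : PerHolderDiff β r fun t => (f t : ℂ)) (hg : PerHolderDiff β r fun t => (g t : ℂ))
    (h0 : ∀ t, g t ≠ 0) : PerHolderDiff β r fun t => ((f t / g t : ℝ) : ℂ) := by
  simpa only [Complex.ofReal_div] using hf.div hβ hg fun t => by simpa using h0 t

lemma PerHolderDiff.ofReal_const (x : ℝ) : PerHolderDiff β r fun _ => (x : ℂ) :=
  PerHolderDiff.const r _

/-- Euler angle decomposition. -/
lemma isApproximable_suTwo_of_half_lt (hr : IsAdmissibleRate β r γ) {ρ x y : ℝ → ℝ}
    (hρ : PerHolderDiff β r fun t => (ρ t : ℂ)) (hx : PerHolderDiff β r fun t => (x t : ℂ))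
    (hy : PerHolderDiff β r fun t => (y t : ℂ)) (h0 : ∀ t, 0 < ρ t)
    (h1 : ∀ t, ρ t ^ 2 + x t ^ 2 + y t ^ 2 = 1) (hX : ∀ t, 0 < 2 * ρ t ^ 2 - 1) :
    IsApproximable β r γ fun t => suTwo (ρ t) (x t + Complex.I * y t) := by
  have hβ := hr.pos
  obtain ⟨X, hXd, hX0, hXe⟩ : ∃ X : ℝ → ℝ, PerHolderDiff β r (fun t => (X t : ℂ)) ∧
      (∀ t, 0 < X t) ∧ ∀ t, X t = 2 * ρ t ^ 2 - 1 := by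
    refine ⟨fun t => 2 * (ρ t * ρ t) + -1, ?_, fun t => ?_, fun t => by ring⟩
    · exact ((PerHolderDiff.ofReal_const 2).ofReal_mul hβ (hρ.ofReal_mul hβ hρ)).ofReal_add
        (PerHolderDiff.ofReal_const (-1))
    · have := hX t
      nlinarith
  obtain ⟨q, hqd, hq0, hqe⟩ : ∃ q : ℝ → ℝ, PerHolderDiff β r (fun t => (q t : ℂ)) ∧
      (∀ t, 0 < q t) ∧ ∀ t, q t ^ 2 = X t ^ 2 + 4 * (ρ t * x t) ^ 2 := by
    have hp : ∀ t, 0 < X t * X t + 4 * ((ρ t * x t) * (ρ t * x t)) := fun t => by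
      have := hX0 t
      nlinarith [mul_pos this this, mul_self_nonneg (ρ t * x t)]
    refine ⟨_, PerHolderDiff.sqrt hβ ?_ hp, fun t => Real.sqrt_pos.2 (hp t), fun t => ?_⟩
    · exact (hXd.ofReal_mul hβ hXd).ofReal_add ((PerHolderDiff.ofReal_const 4).ofReal_mul hβ
        ((hρ.ofReal_mul hβ hx).ofReal_mul hβ (hρ.ofReal_mul hβ hx)))
    · rw [Real.sq_sqrt (hp t).le]; ring
  obtain ⟨c, hcd, hc0, hce⟩ : ∃ c : ℝ → ℝ, PerHolderDiff β r (fun t => (c t : ℂ)) ∧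
      (∀ t, 0 < c t) ∧ ∀ t, c t ^ 2 * q t = (q t + X t) / 2 := by
    have hp : ∀ t, 0 < (q t + X t) / (2 * q t) := fun t => by
      have := hX0 t
      have := hq0 t
      positivity
    refine ⟨_, PerHolderDiff.sqrt hβ ?_ hp, fun t => Real.sqrt_pos.2 (hp t), fun t => ?_⟩
    · exact (hqd.ofReal_add hXd).ofReal_div hβ ((PerHolderDiff.ofReal_const 2).ofReal_mul hβ hqd)
        fun t => by have := hq0 t; positivity
    · rw [Real.sq_sqrt (hp t).le]
      have := (hq0 t).ne'
      field_simp
  obtain ⟨s, hsd, hse⟩ : ∃ s : ℝ → ℝ, PerHolderDiff β r (fun t => (s t : ℂ)) ∧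
      ∀ t, s t * c t * q t = ρ t * x t := by
    refine ⟨fun t => ρ t * x t / (q t * c t), (hρ.ofReal_mul hβ hx).ofReal_div hβ
      (hqd.ofReal_mul hβ hcd) fun t => (mul_pos (hq0 t) (hc0 t)).ne', fun t => ?_⟩
    have := (hq0 t).ne'
    have := (hc0 t).ne'
    field_simp
  obtain ⟨c', hcd', hc0', hce'⟩ : ∃ c : ℝ → ℝ, PerHolderDiff β r (fun t => (c t : ℂ)) ∧
      (∀ t, 0 < c t) ∧ ∀ t, c t ^ 2 = (1 + q t) / 2 := by
    have hp : ∀ t, 0 < (1 + q t) / 2 := fun t => by have := hq0 t; positivity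
    refine ⟨_, PerHolderDiff.sqrt hβ ?_ hp, fun t => Real.sqrt_pos.2 (hp t), fun t => ?_⟩
    · exact ((PerHolderDiff.ofReal_const 1).ofReal_add hqd).ofReal_div hβ
        (PerHolderDiff.ofReal_const 2) fun t => by norm_num
    · rw [Real.sq_sqrt (hp t).le]
  obtain ⟨s', hsd', hse'⟩ : ∃ s : ℝ → ℝ, PerHolderDiff β r (fun t => (s t : ℂ)) ∧
      ∀ t, s t * c' t = ρ t * y t :=
    ⟨fun t => ρ t * y t / c' t, (hρ.ofReal_mul hβ hy).ofReal_div hβ hcd' fun t => (hc0' t).ne',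
      fun t => div_mul_cancel₀ _ (hc0' t).ne'⟩
  have k1 : ∀ t, c t ^ 2 + s t ^ 2 = 1 := fun t => by
    have hne : c t ^ 2 * q t ^ 2 ≠ 0 := by
      have := hq0 t; have := hc0 t; positivity
    refine mul_left_cancel₀ hne ?_
    have e1 : s t ^ 2 * c t ^ 2 * q t ^ 2 = (ρ t * x t) ^ 2 := by rw [← hse t]; ring
    linear_combination (c t ^ 2 * q t + (q t + X t) / 2 - q t) * hce t + e1 - hqe t / 4
  have k2 : ∀ t, c' t ^ 2 + s' t ^ 2 = 1 := fun t => by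
    refine mul_left_cancel₀ (pow_ne_zero 2 (hc0' t).ne') ?_
    have e1 : s' t ^ 2 * c' t ^ 2 = (ρ t * y t) ^ 2 := by rw [← hse' t]; ring
    have e2 : q t ^ 2 + 4 * (ρ t * y t) ^ 2 = 1 := by
      rw [hqe, hXe]
      linear_combination 4 * ρ t ^ 2 * h1 t
    linear_combination (c' t ^ 2 + (1 + q t) / 2 - 1) * hce' t + e1 + e2 / 4
  have k3 : ∀ t, c t ^ 2 * c' t ^ 2 + s t ^ 2 * s' t ^ 2 = ρ t ^ 2 := fun t => by
    have e1 : s t ^ 2 = 1 - c t ^ 2 := by linarith [k1 t]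
    have e2 : s' t ^ 2 = 1 - c' t ^ 2 := by linarith [k2 t]
    rw [e1, e2]
    linear_combination (2 * c t ^ 2 - 1) * hce' t + hce t + hXe t / 2
  have hud : PerHolderDiff β r fun t =>
      ((c t : ℂ) * c' t + -(Complex.I * (s t * s' t))) / (ρ t : ℂ) := by
    refine PerHolderDiff.div hβ ?_ hρ fun t => by simpa using (h0 t).ne'
    exact (hcd.mul hβ hcd').add
      (((PerHolderDiff.const r _).mul hβ (hsd.mul hβ hsd')).neg hβ)
  have hu : ∀ t, ‖((c t : ℂ) * c' t + -(Complex.I * (s t * s' t))) / (ρ t : ℂ)‖ = 1 := fun t => by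
    have e : (c t : ℂ) * c' t + -(Complex.I * (s t * s' t)) =
        ((c t * c' t : ℝ) : ℂ) + ((-(s t * s' t) : ℝ) : ℂ) * Complex.I := by
      push_cast; ring
    rw [norm_div, Complex.norm_real, Real.norm_of_nonneg (h0 t).le, e, Complex.norm_add_mul_I,
      show (c t * c' t) ^ 2 + (-(s t * s' t)) ^ 2 = ρ t ^ 2 by rw [← k3 t]; ring,
      Real.sqrt_sq (h0 t).le, div_self (h0 t).ne']
  have h := ((isApproximable_suTwo_rotation hr hcd hsd k1 (ω := 1) (by simp)).mul hβ
    (isApproximable_suTwo_rotation hr hcd' hsd' k2 (ω := Complex.I)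
      (by rw [star_I, mul_neg, Complex.I_mul_I, neg_neg]))).mul hβ
    (isApproximable_suTwo_diag hr hud hu)
  convert h using 2 with t
  have hne : (ρ t : ℂ) ≠ 0 := by simpa using (h0 t).ne'
  have m1 : (c t : ℂ) ^ 2 + (s t : ℂ) ^ 2 = 1 := by exact_mod_cast k1 t
  have m2 : (c' t : ℂ) ^ 2 + (s' t : ℂ) ^ 2 = 1 := by exact_mod_cast k2 t
  have m3 : (c t : ℂ) ^ 2 * (c' t : ℂ) ^ 2 + (s t : ℂ) ^ 2 * (s' t : ℂ) ^ 2 = (ρ t : ℂ) ^ 2 := by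
    exact_mod_cast k3 t
  have m4 : (s t : ℂ) * c t * q t = ρ t * x t := by exact_mod_cast hse t
  have m5 : (s' t : ℂ) * c' t = ρ t * y t := by exact_mod_cast hse' t
  have m6 : (c' t : ℂ) ^ 2 = (1 + q t) / 2 := by
    have := hce' t
    exact_mod_cast this
  rw [suTwo_mul, suTwo_mul]
  simp only [star_mul, star_neg, star_add, star_div₀, star_zero, star_I, star_ofReal, one_mul,
    mul_zero, zero_add, sub_zero, neg_neg, mul_neg, sub_neg_eq_add]
  congr 1
  · field_simp
    linear_combination -m3 + (s t : ℂ) ^ 2 * (s' t : ℂ) ^ 2 * Complex.I_mul_I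
  · field_simp
    linear_combination -m4 - Complex.I * m5 - Complex.I * s' t * c' t * m1 -
      ((s t : ℂ) * c t * s' t ^ 2) * Complex.I_mul_I - (2 * s t * c t : ℂ) * m6 +
      (s t : ℂ) * c t * m2

lemma isApproximable_suTwo_of_pos (hr : IsAdmissibleRate β r γ) {ρ : ℝ → ℝ} {b : ℝ → ℂ}
    (hρ : PerHolderDiff β r fun t => (ρ t : ℂ)) (hb : PerHolderDiff β r b) (h0 : ∀ t, 0 < ρ t)
    (h1 : ∀ t, ρ t ^ 2 + ‖b t‖ ^ 2 = 1) : IsApproximable β r γ fun t => suTwo (ρ t) (b t) := by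
  have hβ := hr.pos
  have hx : PerHolderDiff β r fun t => ((b t).re : ℂ) := hb.re hβ
  have hy : PerHolderDiff β r fun t => ((b t).im : ℂ) := hb.im hβ
  have hp : ∀ t, 0 < (1 + ρ t) / 2 := fun t => by have := h0 t; positivity
  obtain ⟨q, hqd, hq0, hqe⟩ : ∃ q : ℝ → ℝ, PerHolderDiff β r (fun t => (q t : ℂ)) ∧
      (∀ t, 0 < q t) ∧ ∀ t, q t ^ 2 = (1 + ρ t) / 2 := by
    refine ⟨_, PerHolderDiff.sqrt hβ ?_ hp, fun t => Real.sqrt_pos.2 (hp t),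
      fun t => Real.sq_sqrt (hp t).le⟩
    exact ((PerHolderDiff.ofReal_const 1).ofReal_add hρ).ofReal_div hβ
      (PerHolderDiff.ofReal_const 2) fun t => by norm_num
  have h2q : PerHolderDiff β r fun t => ((2 * q t : ℝ) : ℂ) :=
    (PerHolderDiff.ofReal_const 2).ofReal_mul hβ hqd
  have h2q0 : ∀ t, 2 * q t ≠ 0 := fun t => by have := hq0 t; positivity
  have e : ∀ t, ρ t ^ 2 + (b t).re ^ 2 + (b t).im ^ 2 = 1 := fun t => by
    rw [← h1 t, ← Complex.normSq_eq_norm_sq, Complex.normSq_apply]; ring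
  have h := isApproximable_suTwo_of_half_lt hr hqd (hx.ofReal_div hβ h2q h2q0)
    (hy.ofReal_div hβ h2q h2q0) hq0 (fun t => ?_) (fun t => ?_)
  · convert h.mul hβ h using 2 with t
    have hne : (q t : ℂ) ≠ 0 := by simpa using (hq0 t).ne'
    have m1 : (q t : ℂ) ^ 2 = (1 + ρ t) / 2 := by exact_mod_cast hqe t
    have m2 : (ρ t : ℂ) ^ 2 + ((b t).re : ℂ) ^ 2 + ((b t).im : ℂ) ^ 2 = 1 := by
      exact_mod_cast e t
    rw [suTwo_mul]
    simp only [star_mul, star_add, star_I, star_ofReal]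
    congr 1
    · push_cast
      field_simp
      linear_combination (-4 * (q t : ℂ) ^ 2 + 2 * ρ t - 2) * m1 + m2 -
        ((b t).im : ℂ) ^ 2 * Complex.I_mul_I
    · nth_rewrite 1 [← Complex.re_add_im (b t)]
      push_cast
      field_simp
      ring
  · have := (hq0 t).ne'
    field_simp
    linear_combination (4 * q t ^ 2 + 2 * ρ t - 2) * hqe t + e t
  · rw [hqe]
    linarith [h0 t]

end

/-! ### Elimination -/

/-- `M` fixes all vectors vanishing on `S`. -/
def FixesOff {n : Type*} [Fintype n] (S : Finset n) (M : Matrix n n ℂ) : Prop :=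
  ∀ v : n → ℂ, (∀ i ∈ S, v i = 0) → M.mulVec v = v

lemma injective_pair {n : Type*} {i j : n} (hij : i ≠ j) : Function.Injective ![i, j] := by
  intro p q
  fin_cases p <;> fin_cases q <;> simp [hij, hij.symm]

section

variable {n : Type*} [Fintype n]

lemma FixesOff.mono {S T : Finset n} (h : S ⊆ T) {M : Matrix n n ℂ} (hM : FixesOff S M) :
    FixesOff T M := fun v hv => hM v fun i hi => hv i (h hi)

lemma FixesOff.mul {S : Finset n} {M N : Matrix n n ℂ} (hM : FixesOff S M) (hN : FixesOff S N) :
    FixesOff S (M * N) := fun v hv => by rw [← Matrix.mulVec_mulVec, hN v hv, hM v hv]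

lemma perHolderDiff_mulVec {β : ℝ} {r : ℕ} (hβ : 0 < β) {U : ℝ → Matrix n n ℂ} {u : ℝ → n → ℂ}
    (hU : ∀ i j, PerHolderDiff β r fun t => U t i j) (hu : ∀ k, PerHolderDiff β r fun t => u t k)
    (k : n) : PerHolderDiff β r fun t => (U t).mulVec (u t) k :=
  PerHolderDiff.sum _ fun j _ => (hU k j).mul hβ (hu j)

variable [DecidableEq n]

lemma conjTranspose_mul_self_of_mem {M : Matrix n n ℂ}
    (hM : M ∈ Matrix.specialUnitaryGroup n ℂ) : M.conjTranspose * M = 1 :=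
  Matrix.mem_unitaryGroup_iff'.1 hM.1

lemma mul_conjTranspose_self_of_mem {M : Matrix n n ℂ}
    (hM : M ∈ Matrix.specialUnitaryGroup n ℂ) : M * M.conjTranspose = 1 :=
  Matrix.mem_unitaryGroup_iff.1 hM.1

lemma FixesOff.conjTranspose {S : Finset n} {M : Matrix n n ℂ} (hM : FixesOff S M)
    (hu : M ∈ Matrix.specialUnitaryGroup n ℂ) : FixesOff S M.conjTranspose := fun v hv => by
  nth_rewrite 1 [← hM v hv]
  rw [Matrix.mulVec_mulVec, conjTranspose_mul_self_of_mem hu, Matrix.one_mulVec]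

lemma FixesOff.apply_eq_zero {S : Finset n} {M : Matrix n n ℂ} (hM : FixesOff S M)
    (hu : M ∈ Matrix.specialUnitaryGroup n ℂ) {i k : n} (hk : k ∉ S) (hik : i ≠ k) :
    M k i = 0 := by
  have h := hM.conjTranspose hu (Pi.single k 1) fun j hj =>
    Pi.single_eq_of_ne (ne_of_mem_of_not_mem hj hk) _
  have h' := congrFun h i
  rw [Matrix.mulVec_single_one, Pi.single_eq_of_ne hik] at h'
  simpa using h'

lemma fixesOff_embTwo {S : Finset n} {e : Fin 2 → n} (he : ∀ p, e p ∈ S)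
    (A : Matrix (Fin 2) (Fin 2) ℂ) : FixesOff S (embTwo e A) := fun v hv => by
  have h : v ∘ e = 0 := funext fun p => hv _ (he p)
  funext k
  rw [embTwo_mulVec_apply, h]
  simp [hv _ (he _)]

lemma embTwo_mulVec_zero {i j : n} (hij : i ≠ j) (a b : ℂ) (u : n → ℂ) :
    (embTwo ![i, j] (suTwo a b)).mulVec u i = a * u i + b * u j := by
  rw [embTwo_mulVec_apply]
  simp [hij, suTwo, Matrix.mulVec, dotProduct]

lemma embTwo_mulVec_one {i j : n} (hij : i ≠ j) (a b : ℂ) (u : n → ℂ) :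
    (embTwo ![i, j] (suTwo a b)).mulVec u j = -star b * u i + star a * u j := by
  rw [embTwo_mulVec_apply]
  simp [hij.symm, suTwo, Matrix.mulVec, dotProduct]

lemma embTwo_mulVec_of_ne {i j k : n} (hi : k ≠ i) (hj : k ≠ j) (A : Matrix (Fin 2) (Fin 2) ℂ)
    (u : n → ℂ) : (embTwo ![i, j] A).mulVec u k = u k := by
  rw [embTwo_mulVec_apply]
  simp [hi, hj]

variable {β γ : ℝ} {r : ℕ}

lemma exists_isApproximable_pair (hr : IsAdmissibleRate β r γ) {u : ℝ → n → ℂ}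
    (hu : ∀ k, PerHolderDiff β r fun t => u t k) {i j : n} (hij : i ≠ j) {ρ : ℝ → ℝ}
    (hρ : ∀ t, u t i = ρ t) (h0 : ∀ t, 0 < ρ t) :
    ∃ G : ℝ → Matrix n n ℂ, IsApproximable β r γ G ∧ (∀ t, FixesOff {i, j} (G t)) ∧
      ∃ ρ' : ℝ → ℝ, (∀ t, 0 < ρ' t) ∧ ∀ t, (G t).mulVec (u t) i = ρ' t ∧
        (G t).mulVec (u t) j = 0 ∧ ∀ k, k ≠ i → k ≠ j → (G t).mulVec (u t) k = u t k := by
  have hβ := hr.pos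
  have hρd : PerHolderDiff β r fun t => (ρ t : ℂ) := by simpa only [hρ] using hu i
  have hp : ∀ t, 0 < ρ t * ρ t + ‖u t j‖ ^ 2 := fun t => by
    have := h0 t
    positivity
  obtain ⟨R, hRd, hR0, hRe⟩ : ∃ R : ℝ → ℝ, PerHolderDiff β r (fun t => (R t : ℂ)) ∧
      (∀ t, 0 < R t) ∧ ∀ t, R t ^ 2 = ρ t ^ 2 + ‖u t j‖ ^ 2 := by
    refine ⟨_, PerHolderDiff.sqrt hβ ?_ hp, fun t => Real.sqrt_pos.2 (hp t), fun t => ?_⟩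
    · exact (hρd.ofReal_mul hβ hρd).ofReal_add ((hu j).normSq hβ)
    · rw [Real.sq_sqrt (hp t).le]; ring
  have hRne : ∀ t, (R t : ℂ) ≠ 0 := fun t => by simpa using (hR0 t).ne'
  have h := isApproximable_suTwo_of_pos hr (hρd.ofReal_div hβ hRd fun t => (hR0 t).ne')
    ((hu j).conj.div hβ hRd hRne) (fun t => div_pos (h0 t) (hR0 t)) fun t => by
      rw [norm_div, norm_star, Complex.norm_real, Real.norm_of_nonneg (hR0 t).le, div_pow, div_pow,
        ← add_div, ← hRe, div_self (pow_ne_zero 2 (hR0 t).ne')]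
  refine ⟨_, h.embTwo hβ (injective_pair hij), fun t => fixesOff_embTwo (by simp) _, R, hR0,
    fun t => ⟨?_, ?_, fun k hi hj => embTwo_mulVec_of_ne hi hj _ _⟩⟩
  · rw [embTwo_mulVec_zero hij, hρ]
    have e1 : star (u t j) * u t j = ((‖u t j‖ : ℝ) : ℂ) ^ 2 := by
      rw [← starRingEnd_apply, Complex.conj_mul']
    have e2 : (R t : ℂ) ^ 2 = (ρ t : ℂ) ^ 2 + ((‖u t j‖ : ℝ) : ℂ) ^ 2 := by exact_mod_cast hRe t
    have := hRne t
    push_cast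
    field_simp
    linear_combination e1 - e2
  · rw [embTwo_mulVec_one hij, hρ, star_div₀, star_star, star_ofReal, star_ofReal]
    push_cast
    ring

lemma exists_isApproximable_phase (hr : IsAdmissibleRate β r γ) {u : ℝ → n → ℂ}
    (hu : ∀ k, PerHolderDiff β r fun t => u t k) {i j : n} (hij : i ≠ j)
    (h0 : ∀ t, u t i ≠ 0) :
    ∃ G : ℝ → Matrix n n ℂ, IsApproximable β r γ G ∧ (∀ t, FixesOff {i, j} (G t)) ∧
      ∀ t, (G t).mulVec (u t) i = (‖u t i‖ : ℝ) ∧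
        ∀ k, k ≠ i → k ≠ j → (G t).mulVec (u t) k = u t k := by
  have hβ := hr.pos
  have hne : ∀ t, ((‖u t i‖ : ℝ) : ℂ) ≠ 0 := fun t => by simpa using h0 t
  have h := isApproximable_suTwo_diag hr ((hu i).conj.div hβ ((hu i).norm hβ h0) hne) fun t => by
    rw [norm_div, norm_star, Complex.norm_real, norm_norm, div_self (norm_ne_zero_iff.2 (h0 t))]
  refine ⟨_, h.embTwo hβ (injective_pair hij), fun t => fixesOff_embTwo (by simp) _,
    fun t => ⟨?_, fun k hi hj => embTwo_mulVec_of_ne hi hj _ _⟩⟩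
  rw [embTwo_mulVec_zero hij]
  have e1 : star (u t i) * u t i = ((‖u t i‖ : ℝ) : ℂ) ^ 2 := by
    rw [← starRingEnd_apply, Complex.conj_mul']
  have := hne t
  field_simp
  linear_combination e1

lemma exists_isApproximable_finset (hr : IsAdmissibleRate β r γ) {u : ℝ → n → ℂ}
    (hu : ∀ k, PerHolderDiff β r fun t => u t k) {i : n} {ρ : ℝ → ℝ}
    (hρ : ∀ t, u t i = ρ t) (h0 : ∀ t, 0 < ρ t) (T : Finset n) (hT : i ∉ T) :
    ∃ G : ℝ → Matrix n n ℂ, IsApproximable β r γ G ∧ (∀ t, FixesOff (insert i T) (G t)) ∧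
      ∃ ρ' : ℝ → ℝ, (∀ t, 0 < ρ' t) ∧ ∀ t, (G t).mulVec (u t) i = ρ' t ∧
        (∀ k ∈ T, (G t).mulVec (u t) k = 0) ∧
        ∀ k ∉ insert i T, (G t).mulVec (u t) k = u t k := by
  induction T using Finset.induction_on with
  | empty =>
    refine ⟨fun _ => 1, IsApproximable.const (one_mem _), fun t v _ => Matrix.one_mulVec v, ρ, h0,
      fun t => ⟨?_, by simp, fun k _ => ?_⟩⟩
    · rw [Matrix.one_mulVec, hρ]
    · rw [Matrix.one_mulVec]
  | insert j T hj ih =>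
    rw [Finset.mem_insert, not_or] at hT
    obtain ⟨G, hG, hGf, ρ', hρ', h⟩ := ih hT.2
    obtain ⟨G', hG', hGf', ρ'', hρ'', h'⟩ := exists_isApproximable_pair hr
      (perHolderDiff_mulVec hr.pos hG.diff hu) hT.1 (fun t => (h t).1) hρ'
    refine ⟨_, hG'.mul hr.pos hG, fun t => ((hGf' t).mono ?_).mul ((hGf t).mono ?_), ρ'', hρ'',
      fun t => ?_⟩
    · intro k; simp; tauto
    · intro k; simp; tauto
    · simp only [← Matrix.mulVec_mulVec]
      refine ⟨(h' t).1, fun k hk => ?_, fun k hk => ?_⟩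
      · rcases eq_or_ne k j with rfl | hkj
        · exact (h' t).2.1
        · have hkT : k ∈ T := by simpa [hkj] using hk
          rw [(h' t).2.2 k (fun e => hT.2 (e ▸ hkT)) hkj, (h t).2.1 k hkT]
      · simp only [Finset.mem_insert, not_or] at hk
        rw [(h' t).2.2 k hk.1 hk.2.1, (h t).2.2 k (by simp [hk.1, hk.2.2])]

/-- A vector loop with a nonvanishing coordinate is mapped to a positive multiple of a basis
vector by an approximable loop. -/
lemma exists_isApproximable_mulVec_eq_single (hr : IsAdmissibleRate β r γ) {u : ℝ → n → ℂ}
    (hu : ∀ k, PerHolderDiff β r fun t => u t k) {i j : n} {S : Finset n} (hi : i ∈ S)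
    (hj : j ∈ S) (hij : i ≠ j) (h0 : ∀ t, u t i ≠ 0) (hS : ∀ t, ∀ k ∉ S, u t k = 0) :
    ∃ G : ℝ → Matrix n n ℂ, IsApproximable β r γ G ∧ (∀ t, FixesOff S (G t)) ∧
      ∃ ρ : ℝ → ℝ, (∀ t, 0 < ρ t) ∧ ∀ t, (G t).mulVec (u t) = Pi.single i (ρ t : ℂ) := by
  obtain ⟨G, hG, hGf, h⟩ := exists_isApproximable_phase hr hu hij h0
  obtain ⟨G', hG', hGf', ρ, hρ, h'⟩ := exists_isApproximable_finset hr
    (perHolderDiff_mulVec hr.pos hG.diff hu) (fun t => (h t).1)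
    (fun t => norm_pos_iff.2 (h0 t)) (S.erase i) (Finset.notMem_erase i S)
  rw [Finset.insert_erase hi] at hGf' h'
  refine ⟨_, hG'.mul hr.pos hG, fun t => (hGf' t).mul ((hGf t).mono ?_), ρ, hρ, fun t => ?_⟩
  · intro k
    simp only [Finset.mem_insert, Finset.mem_singleton]
    rintro (rfl | rfl) <;> assumption
  · rw [← Matrix.mulVec_mulVec]
    funext k
    rcases eq_or_ne k i with rfl | hki
    · rw [(h' t).1, Pi.single_eq_same]
    · rw [Pi.single_eq_of_ne hki]
      by_cases hk : k ∈ S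
      · exact (h' t).2.1 k (Finset.mem_erase.2 ⟨hki, hk⟩)
      · rw [(h' t).2.2 k hk, (h t).2 k hki (fun e => hk (e ▸ hj)), hS t k hk]

end

/-! ### Reduction to `SU(2)` -/

section

variable {n : Type*} [Fintype n] [DecidableEq n]

lemma eq_one_of_fixesOff_singleton {i : n} {M : Matrix n n ℂ} (hM : FixesOff {i} M)
    (hu : M ∈ Matrix.specialUnitaryGroup n ℂ) : M = 1 := by
  have hoff : ∀ k l, l ≠ i → M k l = (1 : Matrix n n ℂ) k l := fun k l hl => by
    have h := congrFun (hM (Pi.single l 1) fun j hj => by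
      rw [Finset.mem_singleton] at hj
      exact Pi.single_eq_of_ne (fun e => hl (e.symm.trans hj)) _) k
    rw [Matrix.mulVec_single_one] at h
    rw [Matrix.one_apply]
    simpa [Pi.single_apply, eq_comm] using h
  have hcol : ∀ k, k ≠ i → M k i = 0 := fun k hk =>
    hM.apply_eq_zero hu (by simpa using hk) hk.symm
  have hd : M = Matrix.diagonal fun k => M k k := by
    ext k l
    rcases eq_or_ne k l with rfl | hkl
    · simp
    · rw [Matrix.diagonal_apply_ne _ hkl]
      by_cases hl : l = i
      · subst hl; exact hcol k hkl
      · rw [hoff k l hl, Matrix.one_apply_ne hkl]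
  have hdet : M.det = M i i := by
    rw [hd, Matrix.det_diagonal, Finset.prod_eq_single i]
    · simp
    · intro k _ hk
      rw [hoff k k hk, Matrix.one_apply_eq]
    · simp
  have h1 : M i i = 1 := by rw [← hdet]; exact (Matrix.mem_specialUnitaryGroup_iff.1 hu).2
  ext k l
  by_cases hl : l = i
  · subst hl
    rcases eq_or_ne k l with rfl | hk
    · rw [h1, Matrix.one_apply_eq]
    · rw [hcol k hk, Matrix.one_apply_ne hk]
  · exact hoff k l hl

/-- A column of a `C¹` unitary loop is never orthogonal to a suitable constant vector. -/
lemma exists_forall_conjTranspose_mulVec_ne_zero {U : ℝ → Matrix n n ℂ}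
    (hU : ∀ t, U t ∈ Matrix.specialUnitaryGroup n ℂ)
    (hd : ∀ i j, ContDiff ℝ 1 fun t => U t i j) (i : n) :
    ∃ w : n → ℂ, w i ≠ 0 ∧ ∀ t, (U t).conjTranspose.mulVec w i ≠ 0 := by
  let Φ : ({j : n // j ≠ i} → ℂ) × ℝ → n → ℂ := fun p k => ∑ j, p.1 j * U p.2 k j
  have hΦ : ContDiff ℝ 1 Φ := by
    rw [contDiff_pi]
    intro k
    refine ContDiff.sum fun j _ => ContDiff.mul ?_ ((hd k j).comp contDiff_snd)
    exact (contDiff_apply ℝ ℂ j).comp contDiff_fst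
  have hcard : Fintype.card {j : n // j ≠ i} + 1 = Fintype.card n := by
    have h2 : Fintype.card {j : n // j ≠ i} = Fintype.card n - 1 := by
      rw [Fintype.card_subtype, Finset.filter_ne' Finset.univ i,
        Finset.card_erase_of_mem (Finset.mem_univ i), Finset.card_univ]
    have h1 : 0 < Fintype.card n := Fintype.card_pos_iff.2 ⟨i⟩
    omega
  have hdim : Module.finrank ℝ (({j : n // j ≠ i} → ℂ) × ℝ) < Module.finrank ℝ (n → ℂ) := by
    rw [Module.finrank_prod, Module.finrank_pi_fintype, Module.finrank_pi_fintype]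
    simp only [Complex.finrank_real_complex, Module.finrank_self, Finset.sum_const,
      Finset.card_univ, smul_eq_mul]
    omega
  have hopen : IsOpen {w : n → ℂ | w i ≠ 0} := isOpen_ne_fun (continuous_apply i) continuous_const
  obtain ⟨w, hw, hwΦ⟩ := (hΦ.dense_compl_range_of_finrank_lt_finrank hdim).inter_open_nonempty _
    hopen ⟨fun _ => 1, one_ne_zero⟩
  refine ⟨w, hw, fun t h0 => hwΦ ⟨(fun j => (U t).conjTranspose.mulVec w j, t), ?_⟩⟩
  have hw' : (U t).mulVec ((U t).conjTranspose.mulVec w) = w := by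
    rw [Matrix.mulVec_mulVec, mul_conjTranspose_self_of_mem (hU t), Matrix.one_mulVec]
  nth_rewrite 2 [← hw']
  funext k
  simp only [Φ, Matrix.mulVec, dotProduct] at h0 ⊢
  rw [← Finset.sum_erase Finset.univ (a := i) (by rw [h0, mul_zero]),
    Finset.sum_subtype (p := fun j => j ≠ i) _ (by simp)]
  exact Finset.sum_congr rfl fun j _ => mul_comm _ _

end

section

variable {n : Type*} [Fintype n] [DecidableEq n]

lemma FixesOff.of_insert {i : n} {S : Finset n} {M : Matrix n n ℂ} (hM : FixesOff (insert i S) M)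
    (hi : M.mulVec (Pi.single i 1) = Pi.single i 1) : FixesOff S M := fun v hv => by
  have hv' : v = v i • Pi.single i 1 + Function.update v i 0 := by
    funext k
    rcases eq_or_ne k i with rfl | hk
    · simp
    · simp [hk]
  rw [hv', Matrix.mulVec_add, Matrix.mulVec_smul, hi, hM]
  intro k hk
  rcases eq_or_ne k i with rfl | hki
  · simp
  · rw [Function.update_of_ne hki]
    exact hv k ((Finset.mem_insert.1 hk).resolve_left hki)

lemma eq_one_of_mulVec_single_eq {i : n} {M : Matrix n n ℂ}
    (hu : M ∈ Matrix.specialUnitaryGroup n ℂ) {ρ : ℝ} (hρ : 0 < ρ)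
    (h : M.mulVec (Pi.single i 1) = Pi.single i (ρ : ℂ)) : ρ = 1 := by
  have h1 : (M.conjTranspose * M) i i = 1 := by
    rw [conjTranspose_mul_self_of_mem hu, Matrix.one_apply_eq]
  have h2 : ∀ k, M k i = (Pi.single i (ρ : ℂ) : n → ℂ) k := fun k => by
    rw [← h, Matrix.mulVec_single_one]; rfl
  rw [Matrix.mul_apply, Finset.sum_eq_single i] at h1
  · rw [Matrix.conjTranspose_apply, h2, Pi.single_eq_same] at h1
    have h3 : ρ * ρ = 1 := by exact_mod_cast (by simpa using h1 : (ρ : ℂ) * ρ = 1)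
    nlinarith
  · intro k _ hk
    rw [h2, Pi.single_eq_of_ne hk, mul_zero]
  · simp

variable {β γ : ℝ} {r : ℕ}

/-- A constant rotation makes a diagonal entry of a loop nonvanishing. -/
lemma exists_const_mul_apply_ne_zero (hr : IsAdmissibleRate β (r + 1) γ) {i j : n} {S : Finset n}
    (hi : i ∈ S) (hj : j ∈ S) (hij : i ≠ j) {U : ℝ → Matrix n n ℂ}
    (hU : ∀ t, U t ∈ Matrix.specialUnitaryGroup n ℂ)
    (hd : ∀ i j, PerHolderDiff β (r + 1) fun t => U t i j) (hS : ∀ t, FixesOff S (U t)) :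
    ∃ C ∈ Matrix.specialUnitaryGroup n ℂ, FixesOff S C ∧ ∀ t, (C * U t) i i ≠ 0 := by
  obtain ⟨w, hwi, hw⟩ := exists_forall_conjTranspose_mulVec_ne_zero hU
    (fun i j => (hd i j).contDiff_one hr.pos) i
  let w' : n → ℂ := fun k => if k ∈ S then w k else 0
  have hw' : ∀ t, (U t).conjTranspose.mulVec w' i ≠ 0 := fun t => by
    convert hw t using 1
    refine Finset.sum_congr rfl fun k _ => ?_
    by_cases hk : k ∈ S
    · simp [w', hk]
    · have : U t k i = 0 := (hS t).apply_eq_zero (hU t) hk (ne_of_mem_of_not_mem hi hk)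
      simp [this]
  obtain ⟨G, hG, hGS, ρ, hρ, h⟩ := exists_isApproximable_mulVec_eq_single hr
    (u := fun _ => w') (fun k => PerHolderDiff.const _ _) hi hj hij
    (fun _ => by simpa [w', hi] using hwi) (fun _ k hk => by simp [w', hk])
  refine ⟨G 0, hG.mem 0, hGS 0, fun t h0 => hw' t ?_⟩
  have hwG : w' = (G 0).conjTranspose.mulVec (Pi.single i (ρ 0 : ℂ)) := by
    rw [← h 0, Matrix.mulVec_mulVec, conjTranspose_mul_self_of_mem (hG.mem 0), Matrix.one_mulVec]
  rw [hwG, Matrix.mulVec_mulVec, ← Matrix.conjTranspose_mul, Matrix.mulVec_single]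
  simp [h0, -Matrix.conjTranspose_mul]

/-- Every sufficiently smooth loop in `SU(n)` is approximable. -/
theorem isApproximable_of_fixesOff (hr : IsAdmissibleRate β (r + 1) γ) (S : Finset n) :
    ∀ U : ℝ → Matrix n n ℂ, (∀ t, U t ∈ Matrix.specialUnitaryGroup n ℂ) →
      (∀ i j, PerHolderDiff β (r + 1) fun t => U t i j) → (∀ t, FixesOff S (U t)) →
      IsApproximable β (r + 1) γ U := by
  induction S using Finset.induction_on with
  | empty =>
    intro U hU hd hS
    have h1 : U = fun _ => 1 := funext fun t => by
      refine Matrix.mulVec_injective (funext fun v => ?_)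
      rw [hS t v (by simp), Matrix.one_mulVec]
    rw [h1]
    exact IsApproximable.const (one_mem _)
  | insert i S hi ih =>
    intro U hU hd hS
    rcases S.eq_empty_or_nonempty with rfl | ⟨j, hj⟩
    · have h1 : U = fun _ => 1 := funext fun t => eq_one_of_fixesOff_singleton (hS t) (hU t)
      rw [h1]
      exact IsApproximable.const (one_mem _)
    have hiT := Finset.mem_insert_self i S
    obtain ⟨C, hC, hCS, hC0⟩ := exists_const_mul_apply_ne_zero hr hiT
      (Finset.mem_insert_of_mem hj) (fun e => hi (e ▸ hj)) hU hd hS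
    have hCa : IsApproximable β (r + 1) γ fun _ => C := IsApproximable.const hC
    have hCU : ∀ t, C * U t ∈ Matrix.specialUnitaryGroup n ℂ := fun t => mul_mem hC (hU t)
    have hCUd : ∀ i j, PerHolderDiff β (r + 1) fun t => (C * U t) i j := fun i j =>
      PerHolderDiff.sum _ fun k _ => (PerHolderDiff.const _ _).mul hr.pos (hd k j)
    obtain ⟨G, hG, hGS, ρ, hρ, h⟩ := exists_isApproximable_mulVec_eq_single hr
      (u := fun t k => (C * U t) k i) (fun k => hCUd k i) hiT
      (Finset.mem_insert_of_mem hj) (fun e => hi (e ▸ hj)) hC0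
      (fun t k hk => (hCS.mul (hS t)).apply_eq_zero (hCU t) hk (ne_of_mem_of_not_mem hiT hk))
    have hmem : ∀ t, G t * (C * U t) ∈ Matrix.specialUnitaryGroup n ℂ := fun t =>
      mul_mem (hG.mem t) (hCU t)
    have hcol : ∀ t, (G t * (C * U t)).mulVec (Pi.single i 1) = Pi.single i (ρ t : ℂ) := fun t => by
      rw [← h t, ← Matrix.mulVec_mulVec, Matrix.mulVec_single_one]; rfl
    have hrest := ih (fun t => G t * (C * U t)) hmem
      (fun i j => PerHolderDiff.sum _ fun k _ => (hG.diff i k).mul hr.pos (hCUd k j))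
      fun t => ((hGS t).mul (hCS.mul (hS t))).of_insert (by
        rw [hcol t, eq_one_of_mulVec_single_eq (hmem t) (hρ t) (hcol t), Complex.ofReal_one])
    convert (hG.mul hr.pos hCa).conjTranspose.mul hr.pos hrest using 1
    funext t
    rw [← Matrix.mul_assoc (G t), ← Matrix.mul_assoc,
      conjTranspose_mul_self_of_mem (mul_mem (hG.mem t) hC), Matrix.one_mul]

end

/-! ### Rates in terms of the degree -/

/-- An approximable loop is approximated by trigonometric polynomials of every degree. -/
lemma IsApproximable.exists_forall_degree {n : Type*} [Fintype n] [DecidableEq n] {β γ : ℝ} {r : ℕ}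
    {U : ℝ → Matrix n n ℂ} (hU : IsApproximable β r γ U) (hγ : 0 ≤ γ) :
    ∃ K : ℝ, 0 ≤ K ∧ ∀ k : ℕ, ∃ P : ℝ → Matrix n n ℂ,
      (∀ t, P t ∈ Matrix.specialUnitaryGroup n ℂ) ∧
      (∀ i j, (fun t => P t i j) ∈ trigSpan (-(k : ℤ)) k) ∧
      ∀ t i j, ‖U t i j - P t i j‖ ≤ K * ((k : ℝ) + 1) ^ (-γ) := by
  obtain ⟨d, C, hC, h⟩ := hU.approx
  obtain ⟨m₀, hm₀⟩ := Filter.eventually_atTop.1 h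
  set D : ℕ := d + 1 with hD
  set M : ℕ := max m₀ 1 with hM
  have hM1 : 1 ≤ M := le_max_right _ _
  have hD0 : (0 : ℝ) < D := by positivity
  have hM0 : (0 : ℝ) < M := by exact_mod_cast hM1
  refine ⟨C * (2 * D) ^ γ + 2 * (D * M : ℝ) ^ γ, by positivity, fun k => ?_⟩
  have hk0 : (0 : ℝ) < (k : ℝ) + 1 := by positivity
  have hk : k + 1 ≤ D * (k / D + 1) := Nat.lt_mul_div_succ k (by omega)
  have key : ∀ {a b : ℝ}, 0 < a → 0 < b → (k : ℝ) + 1 ≤ a * b →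
      b ^ (-γ) ≤ a ^ γ * ((k : ℝ) + 1) ^ (-γ) := fun {a b} ha hb hab => by
    rw [Real.rpow_neg hb.le, Real.rpow_neg hk0.le, ← div_eq_mul_inv, inv_eq_one_div,
      div_le_div_iff₀ (by positivity) (by positivity), one_mul, ← Real.mul_rpow ha.le hb.le]
    exact Real.rpow_le_rpow hk0.le hab hγ
  rcases le_or_gt M (k / D) with hkM | hkM
  · obtain ⟨P, hP, hPt, hPU⟩ := hm₀ (k / D) ((le_max_left _ _).trans hkM)
    have hdk : d * (k / D) ≤ k :=
      (Nat.mul_le_mul_right _ (Nat.le_succ d)).trans (Nat.mul_div_le k D)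
    refine ⟨P, hP, fun i j => trigSpan_mono (by omega) (by omega) (hPt i j), fun t i j =>
      (hPU t i j).trans ?_⟩
    have hm1 : 1 ≤ k / D := hM1.trans hkM
    have h1 := key (a := 2 * D) (b := (k / D : ℕ)) (by positivity) (by exact_mod_cast hm1) (by
      have : k + 1 ≤ 2 * D * (k / D) := hk.trans (by nlinarith)
      exact_mod_cast this)
    calc C * ((k / D : ℕ) : ℝ) ^ (-γ) ≤ C * ((2 * D) ^ γ * ((k : ℝ) + 1) ^ (-γ)) := by gcongr
      _ ≤ _ := by
        rw [add_mul, mul_assoc C]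
        exact le_add_of_nonneg_right (by positivity)
  · refine ⟨fun _ => 1, fun _ => one_mem _, fun i j => const_mem_trigSpan (by omega) (by omega) _,
      fun t i j => ?_⟩
    have h1 := key (a := D * M) (b := 1) (by positivity) one_pos (by
      have : k + 1 ≤ D * M * 1 := by
        rw [mul_one]; exact hk.trans (Nat.mul_le_mul_left _ hkM)
      exact_mod_cast this)
    rw [Real.one_rpow] at h1
    have h2 : ‖U t i j - (1 : Matrix n n ℂ) i j‖ ≤ 2 := (norm_sub_le _ _).trans (by
      linarith [norm_entry_le_one (hU.mem t) i j, norm_entry_le_one (one_mem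
        (Matrix.specialUnitaryGroup n ℂ)) i j])
    calc _ ≤ 2 * 1 := by linarith
      _ ≤ 2 * ((D * M : ℝ) ^ γ * ((k : ℝ) + 1) ^ (-γ)) := by gcongr
      _ ≤ _ := by
        rw [add_mul, mul_assoc 2]
        exact le_add_of_nonneg_left (by positivity)

/-! ### Lipschitz classes -/

section

variable {N : ℕ}

lemma norm_apply_le_specNorm (A : Matrix (Fin N) (Fin N) ℂ) (i j : Fin N) :
    ‖A i j‖ ≤ specNorm A := by
  have h := (Matrix.toEuclideanCLM (𝕜 := ℂ) A).le_opNorm (WithLp.toLp 2 (Pi.single j 1))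
  have h1 : ‖WithLp.toLp 2 (Pi.single j (1 : ℂ) : Fin N → ℂ)‖ = 1 :=
    (PiLp.norm_single 2 (fun _ => ℂ) j 1).trans norm_one
  rw [h1, mul_one] at h
  refine le_trans (le_of_eq ?_) ((PiLp.norm_apply_le _ i).trans h)
  rw [Matrix.ofLp_toEuclideanCLM, Matrix.mulVec_single_one, Matrix.col_apply]

lemma exists_specNorm_le (N : ℕ) :
    ∃ K : ℝ, 0 < K ∧ ∀ A : Matrix (Fin N) (Fin N) ℂ, specNorm A ≤ K * ‖A‖ := by
  obtain ⟨K, hK, h⟩ := (LinearMap.toContinuousLinearMap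
    ((Matrix.toEuclideanCLM (n := Fin N) (𝕜 := ℂ)).toAlgEquiv.toLinearMap)).bound
  exact ⟨K, hK, h⟩

lemma iteratedDeriv_apply_apply {F : ℝ → Matrix (Fin N) (Fin N) ℂ} {r : ℕ}
    (hF : ContDiff ℝ r F) (t : ℝ) (i j : Fin N) :
    iteratedDeriv r (fun t => F t i j) t = iteratedDeriv r F t i j := by
  have h := ContinuousLinearMap.iteratedFDeriv_comp_left
    (LinearMap.toContinuousLinearMap (Matrix.entryLinearMap ℝ ℂ i j)) (hF.contDiffAt (x := t))
    le_rfl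
  rw [iteratedDeriv_eq_iteratedFDeriv, iteratedDeriv_eq_iteratedFDeriv]
  exact congrArg (fun T => T fun _ => (1 : ℝ)) h

lemma lipR_pos {α : ℝ} (hα : 1 < α) : 0 < lipR α := by
  have : 1 < ⌈α⌉₊ := Nat.lt_ceil.2 (by exact_mod_cast hα)
  unfold lipR
  omega

lemma lipβ_mem {α : ℝ} (hα : 0 < α) : 0 < lipβ α ∧ lipβ α ≤ 1 := by
  have h1 : 1 ≤ ⌈α⌉₊ := Nat.ceil_pos.2 hα
  have h2 := Nat.le_ceil α
  have h3 := Nat.ceil_lt_add_one hα.le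
  unfold lipβ lipR
  rw [Nat.cast_sub h1, Nat.cast_one]
  constructor <;> linarith

lemma MemLip.perHolderDiff {α : ℝ} (hα : 0 < α) {F : ℝ → Matrix (Fin N) (Fin N) ℂ}
    (hF : MemLip α F) (hp : Function.Periodic F (2 * π)) (i j : Fin N) :
    PerHolderDiff (lipβ α) (lipR α) fun t => F t i j := by
  obtain ⟨hc, C, hC⟩ := hF
  obtain ⟨h0, h1⟩ := lipβ_mem hα
  refine perHolderDiff_of_contDiff h0 h1 (fun t => by rw [hp t])
    ((LinearMap.toContinuousLinearMap (Matrix.entryLinearMap ℝ ℂ i j)).contDiff.comp hc)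
    (le_max_right C 0) fun s t => ?_
  rw [iteratedDeriv_apply_apply hc, iteratedDeriv_apply_apply hc]
  refine (norm_apply_le_specNorm (iteratedDeriv (lipR α) F t - iteratedDeriv (lipR α) F s) i j).trans
    ((hC s t).trans ?_)
  gcongr
  exact le_max_left _ _

lemma isAdmissibleRate_lip {α δ : ℝ} (hα : 1 < α) (hδ : 0 < δ) (hδ' : δ ≤ 1 / 4) :
    IsAdmissibleRate (lipβ α) (lipR α) (α - δ) := by
  obtain ⟨h0, h1⟩ := lipβ_mem (zero_lt_one.trans hα)
  have h : (lipR α : ℝ) + lipβ α = α := by unfold lipβ; ring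
  exact ⟨h0, h1, by linarith, by linarith, by linarith⟩

lemma isPolyLoop_of_mem_trigSpan {k : ℕ} {P : ℝ → Matrix (Fin N) (Fin N) ℂ}
    (hP : ∀ t, P t ∈ Matrix.specialUnitaryGroup (Fin N) ℂ)
    (hPt : ∀ i j, (fun t => P t i j) ∈ trigSpan (-(k : ℤ)) k) :
    IsPolyLoop k (SpecialUnitary N) P := by
  choose c hc using fun i j => exists_coeff_of_mem_trigSpan (hPt i j)
  refine ⟨⟨fun l => Matrix.of fun i j => c i j l, fun t => ?_⟩,
    fun t => Matrix.mem_specialUnitaryGroup_iff.1 (hP t)⟩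
  ext i j
  rw [hc i j t, Matrix.sum_apply]
  exact Finset.sum_congr rfl fun l _ => mul_comm _ _

end

/-- For `N ≥ 2`, `α > 1`, `ε > 0` and any `Lip_α` loop
`U : 𝕋 → SU(N)`, there is a constant `C` and a sequence of `SU(N)`-valued
polynomial loops `Uₙ` of degree `≤ n` with
`‖U - Uₙ‖_C ≤ C (n+1)^{-(α-ε)}` for all `n ≥ 0`. -/
theorem sun_loop_approximation (N : ℕ) (hN : 2 ≤ N) (α ε : ℝ) (hα : 1 < α) (hε : 0 < ε)
    (U : ℝ → Matrix (Fin N) (Fin N) ℂ)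
    (hUper : Function.Periodic U (2 * π))
    (hUlip : MemLip α U)
    (hUsu : ∀ t : ℝ, U t ∈ SpecialUnitary N) :
    ∃ C : ℝ, 0 < C ∧ ∃ Us : ℕ → ℝ → Matrix (Fin N) (Fin N) ℂ,
      ∀ n : ℕ, IsPolyLoop n (SpecialUnitary N) (Us n) ∧
        unifNorm (fun t => U t - Us n t) ≤ C * ((n : ℝ) + 1) ^ (-(α - ε)) := by
  have hδ : 0 < min ε (1 / 4) := lt_min hε (by norm_num)
  have hδ' : min ε (1 / 4) ≤ 1 / 4 := min_le_right _ _
  have hr := isAdmissibleRate_lip hα hδ hδ'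
  have hd := hUlip.perHolderDiff (zero_lt_one.trans hα) hUper
  obtain ⟨r, hrr⟩ := Nat.exists_eq_add_of_lt (lipR_pos hα)
  rw [zero_add] at hrr
  rw [hrr] at hr hd
  have hU := isApproximable_of_fixesOff hr Finset.univ U
    (fun t => Matrix.mem_specialUnitaryGroup_iff.2 (hUsu t)) hd
    fun t v hv => by
      rw [show v = 0 from funext fun i => hv i (Finset.mem_univ i), Matrix.mulVec_zero]
  obtain ⟨K, hK, h⟩ := hU.exists_forall_degree (by linarith)
  choose P hP hPt hPU using h
  obtain ⟨L, hL, hLs⟩ := exists_specNorm_le N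
  refine ⟨L * (K + 1), by positivity, P, fun n =>
    ⟨isPolyLoop_of_mem_trigSpan (hP n) (hPt n), ciSup_le fun t => ?_⟩⟩
  have hn : (1 : ℝ) ≤ (n : ℝ) + 1 := by linarith [Nat.cast_nonneg (α := ℝ) n]
  have h1 : ‖U t - P n t‖ ≤ K * ((n : ℝ) + 1) ^ (-(α - min ε (1 / 4))) :=
    (Matrix.norm_le_iff (by positivity)).2 (hPU n t)
  calc specNorm (U t - P n t) ≤ L * (K * ((n : ℝ) + 1) ^ (-(α - min ε (1 / 4)))) :=
        (hLs _).trans (by gcongr)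
    _ ≤ L * ((K + 1) * ((n : ℝ) + 1) ^ (-(α - ε))) := by
        gcongr
        · linarith
        · exact min_le_left _ _
    _ = _ := by ring
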